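/- Let N(x) denote the number of integers n with 1 ≤ n ≤ x such that n is squarefree and n = ℓ·m, where ℓ is a prime congruent to 2 or 5 modulo 9, m is not divisible by ℓ, and every prime divisor of m is congruent to 1 modulo 3. Then N(x) ~ (C/3) · x · (log log x) / (log x)^{1/2} as x → ∞, where C = (3^{1/4}/(π√2)) · ∏_{p ≡ 1 (mod 3)} (1 − 1/p²)^{1/2}, the product (which converges absolutely) being over all primes p congruent to 1 modulo 3. -/

import Mathlib

open Filter

section Ikehara

open MeasureTheory Set Topology Complex

/-- The boundary Fourier identity and the Riemann-Lebesgue lemma: if the Laplace transform of a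
bounded function extends continuously to the closed half plane, then its averages against
translates of a band-limited kernel tend to zero. -/
theorem tendsto_integral_mul_bandlimited {r : ℝ → ℝ} (hr : Measurable r) {M : ℝ}
    (hM : ∀ v, |r v| ≤ M) {g : ℂ → ℂ} (hg : ContinuousOn g {s | 0 ≤ s.re})
    (hlap : ∀ s : ℂ, 0 < s.re → ∫ v in Ioi (0 : ℝ), (r v : ℂ) * cexp (-(s * v)) = g s)
    {φ K : ℝ → ℝ} (hφ : Continuous φ) (hφc : HasCompactSupport φ) (hK : Continuous K)
    (hKi : Integrable K) (hφK : ∀ v : ℝ, ∫ t : ℝ, (φ t : ℂ) * cexp (-(I * t * v)) = K v) :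
    Tendsto (fun u => ∫ v in Ioi (0 : ℝ), r v * K (v - u)) atTop (𝓝 0) := by
  have hM0 : 0 ≤ M := (abs_nonneg _).trans (hM 0)
  have hφi : Integrable φ := hφ.integrable_of_hasCompactSupport hφc
  have key : ∀ u σ : ℝ, 0 < σ →
      ∫ v in Ioi (0 : ℝ), (r v : ℂ) * cexp (-(σ * v)) * K (v - u) =
        ∫ t : ℝ, (φ t : ℂ) * cexp (I * t * u) * g (σ + I * t) := by
    intro u σ hσ
    have h1 : ∀ v : ℝ, (r v : ℂ) * cexp (-(σ * v)) * K (v - u) =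
        ∫ t : ℝ, (φ t : ℂ) * cexp (I * t * u) * ((r v : ℂ) * cexp (-((σ + I * t) * v))) := by
      intro v
      rw [← hφK, ← integral_const_mul]
      refine integral_congr_ae (Eventually.of_forall fun t => ?_)
      have : cexp (I * t * u) * cexp (-((σ + I * t) * v)) =
          cexp (-(σ * v)) * cexp (-(I * t * ((v - u : ℝ) : ℂ))) := by
        rw [← Complex.exp_add, ← Complex.exp_add]; congr 1; push_cast; ring
      calc _ = (φ t : ℂ) * r v * (cexp (-(σ * v)) * cexp (-(I * t * ((v - u : ℝ) : ℂ)))) := by ring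
        _ = _ := by rw [← this]; ring
    have h2 : ∀ t : ℝ, (φ t : ℂ) * cexp (I * t * u) * g (σ + I * t) =
        ∫ v in Ioi (0 : ℝ), (φ t : ℂ) * cexp (I * t * u) *
          ((r v : ℂ) * cexp (-((σ + I * t) * v))) := by
      intro t
      rw [integral_const_mul, hlap _ (by simpa using hσ)]
    simp_rw [h1, h2]
    refine integral_integral_swap ?_
    have hexp : IntegrableOn (fun v : ℝ => Real.exp (-σ * v)) (Ioi 0) :=
      exp_neg_integrableOn_Ioi 0 hσ
    have hmaj : Integrable (fun z : ℝ × ℝ => (M * Real.exp (-σ * z.1)) * φ z.2)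
        ((volume.restrict (Ioi 0)).prod volume) := (hexp.const_mul M).mul_prod hφi
    refine hmaj.mono ?_ (Eventually.of_forall ?_)
    · have : Measurable (Function.uncurry fun (v t : ℝ) => (φ t : ℂ) * cexp (I * t * u) *
          ((r v : ℂ) * cexp (-((σ + I * t) * v)))) := by
        have := hφ.measurable
        unfold Function.uncurry
        fun_prop
      exact this.aestronglyMeasurable
    · rintro ⟨v, t⟩
      simp only [Function.uncurry, norm_mul, Complex.norm_exp, Complex.norm_real, Real.norm_eq_abs]
      simp only [mul_re, neg_re, add_re, ofReal_re, I_re, I_im, ofReal_im, mul_im, add_im]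
      simp only [zero_mul, mul_zero, sub_zero, zero_add, add_zero, one_mul,
        Real.exp_zero, mul_one, Real.abs_exp, abs_of_nonneg hM0, sub_self]
      rw [neg_mul]
      have := mul_le_mul_of_nonneg_right (hM v) (mul_nonneg (Real.exp_pos (-(σ * v))).le
        (abs_nonneg (φ t)))
      linarith
  have hlim1 : ∀ u : ℝ, Tendsto (fun σ : ℝ =>
      ∫ v in Ioi (0 : ℝ), (r v : ℂ) * cexp (-(σ * v)) * K (v - u)) (𝓝[>] 0)
      (𝓝 (∫ v in Ioi (0 : ℝ), (r v : ℂ) * K (v - u))) := by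
    intro u
    refine tendsto_integral_filter_of_dominated_convergence (fun v => M * |K (v - u)|) ?_ ?_ ?_ ?_
    · refine Eventually.of_forall fun σ => Measurable.aestronglyMeasurable ?_
      have := hK.measurable
      fun_prop
    · filter_upwards [self_mem_nhdsWithin] with σ hσ
      refine (ae_restrict_iff' measurableSet_Ioi).2 (Eventually.of_forall fun v hv => ?_)
      have hσ : (0 : ℝ) < σ := hσ
      have hv : (0 : ℝ) < v := hv
      simp only [norm_mul, Complex.norm_exp, Complex.norm_real, Real.norm_eq_abs]
      refine mul_le_mul_of_nonneg_right ?_ (abs_nonneg _)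
      refine (mul_le_of_le_one_right (abs_nonneg _) ?_).trans (hM v)
      rw [Real.exp_le_one_iff]
      simpa using (mul_pos hσ hv).le
    · exact ((hKi.comp_sub_right u).abs.const_mul M).integrableOn
    · refine Eventually.of_forall fun v => ?_
      have : Continuous (fun σ : ℝ => (r v : ℂ) * cexp (-(σ * v)) * K (v - u)) := by fun_prop
      refine (this.tendsto' 0 _ ?_).mono_left nhdsWithin_le_nhds
      simp
  have hlim2 : ∀ u : ℝ, Tendsto (fun σ : ℝ =>
      ∫ t : ℝ, (φ t : ℂ) * cexp (I * t * u) * g (σ + I * t)) (𝓝[>] 0)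
      (𝓝 (∫ t : ℝ, (φ t : ℂ) * cexp (I * t * u) * g (I * t))) := by
    intro u
    obtain ⟨C, hC⟩ := ((isCompact_Icc (a := (0 : ℝ)) (b := 1)).prod hφc.isCompact
      ).exists_bound_of_continuousOn (f := fun z : ℝ × ℝ => g (z.1 + I * z.2)) (by
        refine hg.comp (by fun_prop) fun z hz => ?_
        simpa using hz.1.1)
    have hgm : ∀ σ : ℝ, 0 ≤ σ → Continuous (fun t : ℝ => g (σ + I * t)) := fun σ hσ =>
      hg.comp_continuous (by fun_prop) fun t => by simpa using hσ
    refine tendsto_integral_filter_of_dominated_convergence (fun t => |φ t| * C) ?_ ?_ ?_ ?_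
    · filter_upwards [self_mem_nhdsWithin] with σ hσ
      have := hgm σ (le_of_lt hσ)
      exact (Continuous.mul (by fun_prop) this).aestronglyMeasurable
    · filter_upwards [self_mem_nhdsWithin, Ioc_mem_nhdsGT (zero_lt_one)] with σ hσ hσ1
      refine Eventually.of_forall fun t => ?_
      have he : ‖cexp (I * t * u)‖ = 1 := by
        rw [Complex.norm_exp]; simp
      rw [norm_mul, norm_mul, he, mul_one, Complex.norm_real, Real.norm_eq_abs]
      by_cases ht : t ∈ tsupport φ
      · exact mul_le_mul_of_nonneg_left (hC (σ, t) ⟨⟨le_of_lt hσ, hσ1.2⟩, ht⟩) (abs_nonneg _)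
      · simp [image_eq_zero_of_notMem_tsupport ht]
    · exact hφi.abs.mul_const C
    · refine Eventually.of_forall fun t => ?_
      refine Tendsto.const_mul _ ?_
      have h0 : ContinuousWithinAt g {s | 0 ≤ s.re} (I * t) := hg _ (by simp)
      refine h0.tendsto.comp (tendsto_nhdsWithin_iff.2 ⟨?_, ?_⟩)
      · have : Continuous (fun σ : ℝ => (σ : ℂ) + I * t) := by fun_prop
        exact (this.tendsto' 0 _ (by simp)).mono_left nhdsWithin_le_nhds
      · filter_upwards [self_mem_nhdsWithin] with σ hσ
        simpa using le_of_lt hσ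
  have heq : ∀ u : ℝ, ((∫ v in Ioi (0 : ℝ), r v * K (v - u) : ℝ) : ℂ) =
      ∫ t : ℝ, (φ t : ℂ) * cexp (I * t * u) * g (I * t) := by
    intro u
    rw [← integral_complex_ofReal]
    push_cast
    refine tendsto_nhds_unique (hlim1 u) ((hlim2 u).congr' ?_)
    filter_upwards [self_mem_nhdsWithin] with σ hσ
    exact (key u σ hσ).symm
  have hRL := (Real.zero_at_infty_fourier (fun t : ℝ => (φ t : ℂ) * g (I * t))).comp
    (show Tendsto (fun u : ℝ => -(u / (2 * Real.pi))) atTop (cocompact ℝ) from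
      (tendsto_neg_atTop_atBot.comp (tendsto_id.atTop_div_const (by positivity))).mono_right
        atBot_le_cocompact)
  have : Tendsto (fun u => ((∫ v in Ioi (0 : ℝ), r v * K (v - u) : ℝ) : ℂ)) atTop (𝓝 0) := by
    refine hRL.congr fun u => ?_
    rw [heq, Function.comp_apply, Real.fourier_eq']
    refine integral_congr_ae (Eventually.of_forall fun t => ?_)
    have : ((-2 * Real.pi * inner ℝ t (-(u / (2 * Real.pi))) : ℝ) : ℂ) * I = I * t * u := by
      simp only [RCLike.inner_apply, conj_trivial]
      push_cast
      field_simp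
    simp only [smul_eq_mul]
    rw [this]
    ring
  exact (Complex.continuous_re.tendsto' 0 0 rfl).comp this

end Ikehara

section Fejer

open MeasureTheory Set Topology

/-- The Fejér kernel on the real line: the cosine transform of the triangle function. -/
noncomputable def fejerKernel (v : ℝ) : ℝ := ∫ t in (0 : ℝ)..1, 2 * (1 - t) * Real.cos (t * v)

theorem fejerKernel_of_ne_zero {v : ℝ} (hv : v ≠ 0) :
    fejerKernel v = 2 * (1 - Real.cos v) / v ^ 2 := by
  have h : ∀ t ∈ uIcc (0 : ℝ) 1, HasDerivAt
      (fun t : ℝ => 2 * (1 - t) * Real.sin (t * v) / v - 2 * Real.cos (t * v) / v ^ 2)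
      (2 * (1 - t) * Real.cos (t * v)) t := by
    intro t _
    have h1 : HasDerivAt (fun t : ℝ => t * v) v t := by
      simpa using (hasDerivAt_id t).mul_const v
    have h2 : HasDerivAt (fun t : ℝ => 2 * (1 - t)) (-2) t := by
      simpa using ((hasDerivAt_id t).const_sub 1).const_mul 2
    convert! ((h2.mul h1.sin).div_const v).sub ((h1.cos.const_mul 2).div_const (v ^ 2)) using 1
    field_simp
    ring
  rw [fejerKernel, intervalIntegral.integral_eq_sub_of_hasDerivAt h
    (Continuous.intervalIntegrable (by fun_prop) _ _)]
  simp
  ring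

theorem continuous_fejerKernel : Continuous fejerKernel := by
  unfold fejerKernel
  exact intervalIntegral.continuous_parametric_intervalIntegral_of_continuous' (by fun_prop) 0 1

theorem fejerKernel_zero : fejerKernel 0 = 1 := by
  simp only [fejerKernel, mul_zero, Real.cos_zero, mul_one]
  rw [intervalIntegral.integral_const_mul, intervalIntegral.integral_sub (by simp) (by simp)]
  norm_num

theorem fejerKernel_nonneg (v : ℝ) : 0 ≤ fejerKernel v := by
  rcases eq_or_ne v 0 with rfl | hv
  · simp [fejerKernel_zero]
  · rw [fejerKernel_of_ne_zero hv]
    have := Real.cos_le_one v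
    exact div_nonneg (by linarith) (sq_nonneg v)

theorem fejerKernel_le (v : ℝ) : fejerKernel v ≤ 8 * (1 + v ^ 2)⁻¹ := by
  rw [← div_eq_mul_inv, le_div_iff₀ (by positivity)]
  rcases eq_or_ne v 0 with rfl | hv
  · norm_num [fejerKernel_zero]
  · have hv2 : 0 < v ^ 2 := by positivity
    rw [fejerKernel_of_ne_zero hv, div_mul_eq_mul_div, div_le_iff₀ hv2]
    have h1 := Real.one_sub_sq_div_two_le_cos (x := v)
    have h2 := Real.neg_one_le_cos v
    nlinarith

theorem integrable_fejerKernel : Integrable fejerKernel := by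
  refine (integrable_inv_one_add_sq.const_mul 8).mono
    continuous_fejerKernel.aestronglyMeasurable (Eventually.of_forall fun v => ?_)
  rw [Real.norm_of_nonneg (fejerKernel_nonneg v), Real.norm_of_nonneg (by positivity)]
  exact fejerKernel_le v

theorem integral_fejerKernel_pos : 0 < ∫ v, fejerKernel v :=
  integral_pos_of_integrable_nonneg_nonzero (x := 0) continuous_fejerKernel
    integrable_fejerKernel fejerKernel_nonneg (by simp [fejerKernel_zero])

theorem fourier_triangle (v : ℝ) :
    ∫ t : ℝ, ((max 0 (1 - |t|) : ℝ) : ℂ) * Complex.exp (-(Complex.I * t * v)) =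
      fejerKernel v := by
  set φ : ℝ → ℝ := fun t => max 0 (1 - |t|) with hφ
  have hφc : Continuous φ := by fun_prop
  have hφs : HasCompactSupport φ := by
    refine HasCompactSupport.intro (isCompact_Icc (a := -1) (b := 1)) fun t ht => ?_
    simp only [hφ, max_eq_left_iff, sub_nonpos]
    by_contra! h
    exact ht (abs_le.1 h.le)
  have h_int : ∀ w : ℝ, Integrable fun t : ℝ => (φ t : ℂ) * Complex.exp (-(Complex.I * t * w)) := by
    intro w
    refine Continuous.integrable_of_hasCompactSupport (by fun_prop) ?_
    exact (hφs.comp_left (g := fun x : ℝ => (x : ℂ)) (by simp)).mul_right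
  have h1 : ∫ t : ℝ, (φ t : ℂ) * Complex.exp (-(Complex.I * t * v)) =
      ∫ t : ℝ, (φ t : ℂ) * Complex.exp (-(Complex.I * t * (-v : ℝ))) := by
    rw [← integral_neg_eq_self]
    refine integral_congr_ae (Eventually.of_forall fun t => ?_)
    simp [hφ]
  have h2 : ∫ t : ℝ, (φ t : ℂ) * Complex.exp (-(Complex.I * t * v)) =
      ∫ t : ℝ, ((φ t * Real.cos (t * v) : ℝ) : ℂ) := by
    have := integral_add (h_int v) (h_int (-v))
    rw [← h1] at this
    rw [← mul_right_inj' (two_ne_zero (α := ℂ)), two_mul, ← this, ← integral_const_mul]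
    refine integral_congr_ae (Eventually.of_forall fun t => ?_)
    simp only
    push_cast
    rw [← mul_add, mul_left_comm, Complex.two_cos]
    congr 1
    rw [add_comm]
    congr 2 <;> ring
  rw [h2, integral_complex_ofReal]
  congr 1
  have h3 : ∫ t : ℝ, φ t * Real.cos (t * v) =
      ∫ t : ℝ, (fun x : ℝ => φ x * Real.cos (x * v)) |t| := by
    refine integral_congr_ae (Eventually.of_forall fun t => ?_)
    rcases abs_choice t with h | h <;> simp [hφ, h]
  rw [h3.trans (integral_comp_abs (f := fun x => φ x * Real.cos (x * v))), fejerKernel,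
    intervalIntegral.integral_of_le zero_le_one, ← integral_const_mul,
    setIntegral_eq_of_subset_of_forall_sdiff_eq_zero (s := Ioc 0 1)
      (f := fun t => 2 * (φ t * Real.cos (t * v))) measurableSet_Ioi Ioc_subset_Ioi_self]
  · refine setIntegral_congr_fun measurableSet_Ioc fun t ht => ?_
    have : φ t = 1 - t := by
      simp only [hφ, abs_of_pos ht.1]
      exact max_eq_right (by linarith [ht.2])
    simp only [this]; ring
  · rintro t ⟨ht0, ht1⟩
    have ht0 : 0 < t := ht0
    have : φ t = 0 := by
      simp only [hφ, abs_of_pos ht0]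
      refine max_eq_left ?_
      by_contra! h
      exact ht1 ⟨ht0, by linarith⟩
    simp [this]

theorem fourier_triangle_scaled {T : ℝ} (hT : 0 < T) (v : ℝ) :
    ∫ t : ℝ, ((max 0 (1 - |t / T|) : ℝ) : ℂ) * Complex.exp (-(Complex.I * t * v)) =
      ((T * fejerKernel (T * v) : ℝ) : ℂ) := by
  have := Measure.integral_comp_div
    (fun t : ℝ => ((max 0 (1 - |t|) : ℝ) : ℂ) * Complex.exp (-(Complex.I * t * (T * v : ℝ)))) T
  rw [fourier_triangle, abs_of_pos hT, Complex.real_smul] at this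
  rw [Complex.ofReal_mul, ← this]
  refine integral_congr_ae (Eventually.of_forall fun t => ?_)
  have hT' : (T : ℂ) ≠ 0 := by exact_mod_cast hT.ne'
  simp only
  congr 2
  push_cast
  field_simp

end Fejer

section Tauberian

open MeasureTheory Set Topology

/-- A Wiener-Ikehara theorem for monotone functions of linear growth. -/
theorem Monotone.tendsto_div_of_laplace {S : ℝ → ℝ} (hS : Monotone S) (hS0 : ∀ x, 0 ≤ S x) {M : ℝ}
    (hM : ∀ x, 0 ≤ x → S x ≤ M * x) {A : ℝ} (hA : 0 ≤ A) {g : ℂ → ℂ}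
    (hg : ContinuousOn g {s | 0 ≤ s.re})
    (hlap : ∀ s : ℂ, 0 < s.re → ∫ v in Ioi (0 : ℝ),
      ((S (Real.exp v) * Real.exp (-v) - A : ℝ) : ℂ) * Complex.exp (-(s * v)) = g s) :
    Tendsto (fun x => S x / x) atTop (𝓝 A) := by
  set β : ℝ → ℝ := fun v => S (Real.exp v) * Real.exp (-v) with hβ
  have hβm : Measurable β := by
    have := hS.measurable
    fun_prop
  have hβ0 : ∀ v, 0 ≤ β v := fun v => mul_nonneg (hS0 _) (Real.exp_pos _).le
  have hβM : ∀ v, β v ≤ M := fun v => by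
    have := mul_le_mul_of_nonneg_right (hM _ (Real.exp_pos v).le) (Real.exp_pos (-v)).le
    rwa [mul_assoc, ← Real.exp_add, add_neg_cancel, Real.exp_zero, mul_one] at this
  have hM0 : 0 ≤ M := (hβ0 0).trans (hβM 0)
  have hβmono : ∀ u v, u ≤ v → β u * Real.exp (u - v) ≤ β v := fun u v huv => by
    have := mul_le_mul_of_nonneg_right (hS (Real.exp_le_exp.2 huv)) (Real.exp_pos (-v)).le
    calc β u * Real.exp (u - v) = S (Real.exp u) * Real.exp (-v) := by
          rw [hβ, mul_assoc, ← Real.exp_add]; congr 2; ring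
      _ ≤ _ := this
  set I : ℝ := ∫ v, fejerKernel v with hI
  have hIpos : 0 < I := integral_fejerKernel_pos
  set c : ℝ → ℝ := fun n => ∫ v in (-n)..n, fejerKernel v with hc
  have hclim : Tendsto c atTop (𝓝 I) :=
    intervalIntegral_tendsto_integral integrable_fejerKernel tendsto_neg_atTop_atBot tendsto_id
  have hK : ∀ T : ℝ, 0 < T → Continuous fun v => T * fejerKernel (T * v) := fun T hT =>
    continuous_const.mul (continuous_fejerKernel.comp (continuous_const.mul continuous_id))
  have hKi : ∀ T : ℝ, 0 < T → Integrable fun v => T * fejerKernel (T * v) := fun T hT =>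
    (integrable_fejerKernel.comp_mul_left' hT.ne').const_mul T
  have hKI : ∀ T : ℝ, 0 < T → ∫ v, T * fejerKernel (T * v) = I := fun T hT => by
    rw [integral_const_mul, Measure.integral_comp_mul_left, abs_of_pos (inv_pos.2 hT), smul_eq_mul,
      mul_inv_cancel_left₀ hT.ne']
  have hK0 : ∀ T : ℝ, 0 < T → ∀ v, 0 ≤ T * fejerKernel (T * v) := fun T hT v =>
    mul_nonneg hT.le (fejerKernel_nonneg _)
  have hKc : ∀ T d u : ℝ, 0 < T → ∫ v in (u - d)..(u + d), T * fejerKernel (T * (v - u)) =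
      c (T * d) := fun T d u hT => by
    rw [intervalIntegral.integral_comp_sub_right (fun v => T * fejerKernel (T * v)),
      intervalIntegral.integral_const_mul, intervalIntegral.integral_comp_mul_left _ hT.ne',
      smul_eq_mul, mul_inv_cancel_left₀ hT.ne']
    simp [hc]
  have hbK : ∀ T u : ℝ, 0 < T → Integrable fun v => β v * (T * fejerKernel (T * (v - u))) := by
    intro T u hT
    refine ((hKi T hT).comp_sub_right u).bdd_mul hβm.aestronglyMeasurable
      (Eventually.of_forall fun v => ?_) (c := M)
    rw [Real.norm_of_nonneg (hβ0 v)]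
    exact hβM v
  have hlim : ∀ T : ℝ, 0 < T → Tendsto (fun u => ∫ v in Ioi (0 : ℝ),
      β v * (T * fejerKernel (T * (v - u)))) atTop (𝓝 (A * I)) := by
    intro T hT
    have h1 : Tendsto (fun u => ∫ v in Ioi (0 : ℝ),
        (β v - A) * (T * fejerKernel (T * (v - u)))) atTop (𝓝 0) := by
      refine tendsto_integral_mul_bandlimited (hβm.sub_const A) (M := M + A) (fun v => ?_) hg hlap
        (φ := fun t => max 0 (1 - |t / T|)) (by fun_prop) ?_ (hK T hT) (hKi T hT)
        (fourier_triangle_scaled hT)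
      · rw [abs_le]
        constructor <;> linarith [hβ0 v, hβM v]
      · refine HasCompactSupport.intro (isCompact_Icc (a := -T) (b := T)) fun t ht => ?_
        simp only [max_eq_left_iff, sub_nonpos]
        by_contra! h
        rw [abs_div, abs_of_pos hT, div_lt_one hT] at h
        exact ht (abs_le.1 h.le)
    have h2 : Tendsto (fun u => ∫ v in Ioi (0 : ℝ), T * fejerKernel (T * (v - u))) atTop
        (𝓝 I) := by
      have : ∀ u : ℝ, ∫ v in Ioi (0 : ℝ), T * fejerKernel (T * (v - u)) =
          I - ∫ v in Iic (-u), T * fejerKernel (T * v) := by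
        intro u
        have h3 := intervalIntegral.integral_Iic_add_Ioi
          (f := fun v => T * fejerKernel (T * v)) (b := -u) (hKi T hT).integrableOn
          (hKi T hT).integrableOn
        rw [hKI T hT] at h3
        rw [← h3, add_sub_cancel_left]
        have h6 := (measurePreserving_sub_right volume u).setIntegral_preimage_emb
          (Homeomorph.subRight u).measurableEmbedding (fun v => T * fejerKernel (T * v)) (Ioi (-u))
        rwa [preimage_sub_const_Ioi, neg_add_cancel] at h6
      simp_rw [this]
      have h4 := tendsto_integral_Iic_zero (f := fun v => T * fejerKernel (T * v))
        (μ := volume) tendsto_neg_atTop_atBot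
      simpa using tendsto_const_nhds.sub h4
    have h5 := h1.add (h2.const_mul A)
    rw [zero_add] at h5
    refine h5.congr fun u => ?_
    rw [← integral_const_mul, ← integral_add]
    · exact integral_congr_ae (Eventually.of_forall fun v => by simp only; ring)
    · refine (((hbK T u hT).sub (((hKi T hT).comp_sub_right u).const_mul A)).congr
        (Eventually.of_forall fun v => ?_)).integrableOn
      simp only [Pi.sub_apply]; ring
    · exact (((hKi T hT).comp_sub_right u).const_mul A).integrableOn
  have hup : ∀ T d u : ℝ, 0 < T → 0 < d → 0 ≤ u → β u * Real.exp (-(2 * d)) * c (T * d) ≤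
      ∫ v in Ioi (0 : ℝ), β v * (T * fejerKernel (T * (v - (u + d)))) := by
    intro T d u hT hd hu
    rw [← hKc T d (u + d) hT, ← intervalIntegral.integral_const_mul,
      intervalIntegral.integral_of_le (by linarith)]
    calc _ ≤ ∫ v in Ioc (u + d - d) (u + d + d), β v * (T * fejerKernel (T * (v - (u + d)))) := by
          refine setIntegral_mono_on ?_ (hbK T _ hT).integrableOn measurableSet_Ioc fun v hv => ?_
          · exact (((hKi T hT).comp_sub_right (u + d)).const_mul _).integrableOn
          · refine mul_le_mul_of_nonneg_right ?_ (hK0 T hT _)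
            refine le_trans ?_ (hβmono u v (by linarith [hv.1]))
            exact mul_le_mul_of_nonneg_left (Real.exp_le_exp.2 (by linarith [hv.2])) (hβ0 u)
      _ ≤ _ := by
          refine setIntegral_mono_set (hbK T _ hT).integrableOn
            (Eventually.of_forall fun v => mul_nonneg (hβ0 v) (hK0 T hT _)) ?_
          refine LE.le.eventuallyLE fun v hv => ?_
          exact lt_of_le_of_lt (by linarith) hv.1
  have hlow : ∀ T d u : ℝ, 0 < T → 0 < d → ∫ v in Ioi (0 : ℝ),
      β v * (T * fejerKernel (T * (v - (u - d)))) ≤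
        β u * Real.exp (2 * d) * I + M * (I - c (T * d)) := by
    intro T d u hT hd
    have hi := (hKi T hT).comp_sub_right (u - d)
    have hII : ∫ v, T * fejerKernel (T * (v - (u - d))) = I := by
      rw [integral_sub_right_eq_self (fun v => T * fejerKernel (T * v)), hKI T hT]
    calc _ ≤ ∫ v, β v * (T * fejerKernel (T * (v - (u - d)))) :=
          setIntegral_le_integral (hbK T _ hT)
            (Eventually.of_forall fun v => mul_nonneg (hβ0 v) (hK0 T hT _))
      _ ≤ ∫ v, ((β u * Real.exp (2 * d) + M) * (T * fejerKernel (T * (v - (u - d)))) -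
            (Ioc (u - d - d) (u - d + d)).indicator
              (fun v => M * (T * fejerKernel (T * (v - (u - d))))) v) := by
          refine integral_mono (hbK T _ hT)
            ((hi.const_mul _).sub ((hi.const_mul M).indicator measurableSet_Ioc)) fun v => ?_
          have hk := hK0 T hT (v - (u - d))
          have hb := hβ0 u
          by_cases hv : v ∈ Ioc (u - d - d) (u - d + d)
          · simp only [indicator_of_mem hv]
            rw [← sub_mul, add_sub_cancel_right]
            refine mul_le_mul_of_nonneg_right ?_ hk
            have h1 := hβmono v u (by linarith [hv.2])
            have h2 : β v = β v * Real.exp (v - u) * Real.exp (u - v) := by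
              rw [mul_assoc, ← Real.exp_add]; simp
            rw [h2]
            exact mul_le_mul h1 (Real.exp_le_exp.2 (by linarith [hv.1])) (Real.exp_pos _).le hb
          · simp only [indicator_of_notMem hv, sub_zero]
            refine mul_le_mul_of_nonneg_right ?_ hk
            have := mul_nonneg hb (Real.exp_pos (2 * d)).le
            linarith [hβM v]
      _ = _ := by
          rw [integral_sub (hi.const_mul _) ((hi.const_mul M).indicator measurableSet_Ioc),
            integral_indicator measurableSet_Ioc, integral_const_mul (β u * _ + M),
            integral_const_mul M, hII, ← hKc T d (u - d) hT,
            intervalIntegral.integral_of_le (by linarith)]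
          ring
  have hβlim : Tendsto β atTop (𝓝 A) := by
    have hinv : Tendsto (fun n : ℝ => 1 / n) atTop (𝓝 0) := by
      simpa using tendsto_inv_atTop_zero (𝕜 := ℝ)
    have he : ∀ k : ℝ, Tendsto (fun n : ℝ => Real.exp (k * (1 / n))) atTop (𝓝 1) := fun k => by
      simpa [Function.comp_def] using (Real.continuous_exp.tendsto _).comp (hinv.const_mul k)
    have hmul : ∀ n : ℝ, 0 < n → n ^ 2 * (1 / n) = n := fun n hn => by field_simp
    refine tendsto_order.2 ⟨fun a ha => ?_, fun a ha => ?_⟩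
    · have hn : Tendsto (fun n : ℝ => A * I - (a * Real.exp (2 * (1 / n)) * I + M * (I - c n)))
          atTop (𝓝 (A * I - (a * 1 * I + M * (I - I)))) :=
        (((he 2).const_mul a).mul_const I |>.add ((hclim.const_sub I).const_mul M)).const_sub _
      have hpos : 0 < A * I - (a * 1 * I + M * (I - I)) := by
        have := mul_lt_mul_of_pos_right ha hIpos
        linarith
      obtain ⟨n, hn1, hn0⟩ := ((hn.eventually_const_lt hpos).and (eventually_gt_atTop 0)).exists
      have hd : (0 : ℝ) < 1 / n := by positivity
      have hT : (0 : ℝ) < n ^ 2 := by positivity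
      have := (hlim (n ^ 2) hT).comp (tendsto_atTop_add_const_right atTop (-(1 / n)) tendsto_id)
      filter_upwards [this.eventually_const_lt (show
          a * Real.exp (2 * (1 / n)) * I + M * (I - c n) < A * I by linarith)] with u hu
      have h1 := hu.trans_le (hlow (n ^ 2) (1 / n) u hT hd)
      rw [hmul n hn0, add_lt_add_iff_right] at h1
      exact lt_of_mul_lt_mul_right (lt_of_mul_lt_mul_right h1 hIpos.le) (Real.exp_pos _).le
    · have hn : Tendsto (fun n : ℝ => a * Real.exp (-2 * (1 / n)) * c n - A * I)
          atTop (𝓝 (a * 1 * I - A * I)) :=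
        (((he (-2)).const_mul a).mul hclim).sub_const _
      have hpos : 0 < a * 1 * I - A * I := by
        have := mul_lt_mul_of_pos_right ha hIpos
        linarith
      obtain ⟨n, ⟨hn1, hn2⟩, hn0⟩ := (((hn.eventually_const_lt hpos).and
        (hclim.eventually_const_lt hIpos)).and (eventually_gt_atTop 0)).exists
      have hd : (0 : ℝ) < 1 / n := by positivity
      have hT : (0 : ℝ) < n ^ 2 := by positivity
      have := (hlim (n ^ 2) hT).comp (tendsto_atTop_add_const_right atTop (1 / n) tendsto_id)
      filter_upwards [this.eventually_lt_const (show
          A * I < a * Real.exp (-2 * (1 / n)) * c n by linarith),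
        eventually_ge_atTop 0] with u hu hu0
      have h1 := (hup (n ^ 2) (1 / n) u hT hd hu0).trans_lt hu
      rw [hmul n hn0, ← neg_mul] at h1
      exact lt_of_mul_lt_mul_right (lt_of_mul_lt_mul_right h1 hn2.le) (Real.exp_pos _).le
  refine (hβlim.comp Real.tendsto_log_atTop).congr' ?_
  filter_upwards [eventually_gt_atTop 0] with x hx
  simp [hβ, Real.exp_neg, Real.exp_log hx, div_eq_mul_inv]

end Tauberian

section PrimesInAP

open MeasureTheory Set Topology ArithmeticFunction vonMangoldt Asymptotics

theorem sum_residueClass_le {q : ℕ} (a : ZMod q) {x : ℝ} (hx : 0 ≤ x) :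
    ∑ n ∈ Finset.Icc 1 ⌊x⌋₊, residueClass a n ≤ (Real.log 4 + 4) * x := by
  refine (Finset.sum_le_sum fun n _ => residueClass_le a n).trans ?_
  exact Chebyshev.psi_le_const_mul_self hx

/-- The prime number theorem in arithmetic progressions, with von Mangoldt weights. -/
theorem tendsto_sum_residueClass_div {q : ℕ} [NeZero q] {a : ZMod q} (ha : IsUnit a) :
    Tendsto (fun x : ℝ => (∑ n ∈ Finset.Icc 1 ⌊x⌋₊, residueClass a n) / x) atTop
      (𝓝 (q.totient : ℝ)⁻¹) := by
  have hmono : Monotone fun x : ℝ => ∑ n ∈ Finset.Icc 1 ⌊x⌋₊, residueClass a n := fun x y hxy =>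
    Finset.sum_le_sum_of_subset_of_nonneg (Finset.Icc_subset_Icc_right (Nat.floor_mono hxy))
      fun n _ _ => residueClass_nonneg a n
  have hcont : ContinuousOn (fun s : ℂ => (LFunctionResidueClassAux a (1 + s) -
      ((q.totient : ℝ)⁻¹ : ℝ)) / (1 + s)) {s | 0 ≤ s.re} := by
    have hmap : MapsTo (fun s : ℂ => 1 + s) {s | 0 ≤ s.re} {s | 1 ≤ s.re} := fun s hs => by
      simpa using hs
    refine ContinuousOn.div ?_ (by fun_prop) fun s hs h => ?_
    · exact ((continuousOn_LFunctionResidueClassAux a).comp (by fun_prop) hmap).sub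
        continuousOn_const
    · have h1 : 1 ≤ (1 + s).re := hmap hs
      rw [h, Complex.zero_re] at h1
      linarith
  refine hmono.tendsto_div_of_laplace
    (fun x => Finset.sum_nonneg fun n _ => residueClass_nonneg a n)
    (fun x hx => sum_residueClass_le a hx) (inv_nonneg.2 (Nat.cast_nonneg _)) hcont fun s hs => ?_
  have hs0 : s ≠ 0 := fun h => by simp [h] at hs
  have hs1 : 1 < (1 + s).re := by simpa using hs
  have hs1' : 1 + s ≠ 0 := fun h => by rw [h, Complex.zero_re] at hs1; linarith
  have hO : (fun n : ℕ => ∑ k ∈ Finset.Icc 1 n, residueClass a k) =O[atTop]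
      fun n => (n : ℝ) ^ (1 : ℝ) := by
    refine IsBigO.of_bound (Real.log 4 + 4) (Eventually.of_forall fun n => ?_)
    have := sum_residueClass_le a (Nat.cast_nonneg (α := ℝ) n)
    rw [Nat.floor_natCast] at this
    rw [Real.rpow_one, Real.norm_of_nonneg (Nat.cast_nonneg _), Real.norm_of_nonneg
      (Finset.sum_nonneg fun k _ => residueClass_nonneg a k)]
    exact this
  have hL := LSeries_eq_mul_integral_of_nonneg (residueClass a) zero_le_one hs1 hO
    (residueClass_nonneg a)
  rw [show (1 : ℝ) = Real.exp 0 by simp, ← integral_comp_exp_Ioi] at hL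
  have hcongr : ∀ v : ℝ, Real.exp v • ((∑ k ∈ Finset.Icc 1 ⌊Real.exp v⌋₊,
      ((residueClass a k : ℝ) : ℂ)) * ((Real.exp v : ℝ) : ℂ) ^ (-(1 + s + 1))) =
      ((∑ k ∈ Finset.Icc 1 ⌊Real.exp v⌋₊, residueClass a k : ℝ) * Real.exp (-v) : ℝ) *
        Complex.exp (-(s * v)) := fun v => by
    rw [Complex.cpow_def_of_ne_zero (by simp), ← Complex.ofReal_log (Real.exp_pos _).le,
      Real.log_exp, Complex.real_smul]
    push_cast
    have : Complex.exp v * Complex.exp (v * (-(1 + s + 1))) =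
        Complex.exp (-v) * Complex.exp (-(s * v)) := by
      rw [← Complex.exp_add, ← Complex.exp_add]; congr 1; ring
    linear_combination (∑ k ∈ Finset.Icc 1 ⌊Real.exp v⌋₊, ((residueClass a k : ℝ) : ℂ)) * this
  simp_rw [hcongr] at hL
  have hre : (-s).re < 0 := by simpa using hs
  have hAi : IntegrableOn (fun v : ℝ => (((q.totient : ℝ)⁻¹ : ℝ) : ℂ) * Complex.exp (-(s * v)))
      (Ioi 0) := by
    simpa [neg_mul, IntegrableOn] using (integrableOn_exp_mul_complex_Ioi hre 0).const_mul
      (((q.totient : ℝ)⁻¹ : ℝ) : ℂ)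
  have hSi : IntegrableOn (fun v : ℝ => ((((∑ k ∈ Finset.Icc 1 ⌊Real.exp v⌋₊, residueClass a k : ℝ) *
      Real.exp (-v) : ℝ)) : ℂ) * Complex.exp (-(s * v))) (Ioi 0) := by
    refine (integrableOn_exp_mul_complex_Ioi hre 0).norm.const_mul (Real.log 4 + 4) |>.mono' ?_ ?_
    · have h1 := hmono.measurable
      have h2 : Measurable fun v : ℝ => ∑ k ∈ Finset.Icc 1 ⌊Real.exp v⌋₊, residueClass a k :=
        h1.comp Real.measurable_exp
      exact Measurable.aestronglyMeasurable (by fun_prop)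
    · refine Eventually.of_forall fun v => ?_
      rw [norm_mul, neg_mul, Complex.norm_real, Real.norm_of_nonneg (mul_nonneg
        (Finset.sum_nonneg fun k _ => residueClass_nonneg a k) (Real.exp_pos _).le)]
      refine mul_le_mul_of_nonneg_right ?_ (norm_nonneg _)
      have := mul_le_mul_of_nonneg_right (sum_residueClass_le a (Real.exp_pos v).le)
        (Real.exp_pos (-v)).le
      rwa [mul_assoc, ← Real.exp_add, add_neg_cancel, Real.exp_zero, mul_one] at this
  have hA : ∫ v in Ioi (0 : ℝ), (((q.totient : ℝ)⁻¹ : ℝ) : ℂ) * Complex.exp (-(s * v)) =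
      ((q.totient : ℝ)⁻¹ : ℝ) / s := by
    have := integral_exp_mul_complex_Ioi hre 0
    simp only [neg_mul, Complex.ofReal_zero, mul_zero, Complex.exp_zero] at this
    rw [integral_const_mul, this, neg_div_neg_eq, mul_one_div]
  simp_rw [Complex.ofReal_sub, sub_mul]
  rw [integral_sub hSi hAi, hA, eqOn_LFunctionResidueClassAux ha hs1]
  simp only [add_sub_cancel_left]
  rw [hL]
  generalize ∫ v in Ioi (0 : ℝ), (_ : ℂ) = J
  have hq : (q.totient : ℂ) ≠ 0 := by
    exact_mod_cast (Nat.totient_pos.2 (NeZero.pos q)).ne'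
  push_cast
  field_simp
  ring

end PrimesInAP

section PrimeTheta

open Set Topology ArithmeticFunction vonMangoldt

open Classical in
/-- The first Chebyshev function restricted to the primes satisfying `P`. -/
noncomputable def primeTheta (P : ℕ → Prop) (x : ℝ) : ℝ :=
  ∑ n ∈ Finset.Icc 1 ⌊x⌋₊, if n.Prime ∧ P n then Real.log n else 0

theorem primeTheta_nonneg (P : ℕ → Prop) (x : ℝ) : 0 ≤ primeTheta P x :=
  Finset.sum_nonneg fun n _ => by split_ifs <;> [exact Real.log_natCast_nonneg n; exact le_rfl]

theorem primeTheta_le (P : ℕ → Prop) {x : ℝ} (hx : 0 ≤ x) : primeTheta P x ≤ Real.log 4 * x := by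
  refine le_trans ?_ (Chebyshev.theta_le_log4_mul_x hx)
  rw [Chebyshev.theta, Finset.sum_filter]
  refine Finset.sum_le_sum fun n _ => ?_
  have := Real.log_natCast_nonneg n
  split_ifs <;> simp_all

theorem tendsto_primeTheta_residue {q : ℕ} [NeZero q] {a : ZMod q} (ha : IsUnit a) :
    Tendsto (fun x : ℝ => primeTheta (fun p => (p : ZMod q) = a) x / x) atTop
      (𝓝 (q.totient : ℝ)⁻¹) := by
  classical
  obtain ⟨C, hC⟩ := Chebyshev.psi_sub_theta_le_mul_sqrt
  have h0 : Tendsto (fun x : ℝ => C * √x / x) atTop (𝓝 0) := by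
    have : Tendsto (fun x : ℝ => C * (√x)⁻¹) atTop (𝓝 (C * 0)) :=
      (tendsto_inv_atTop_zero.comp Real.tendsto_sqrt_atTop).const_mul C
    rw [mul_zero] at this
    refine this.congr' ?_
    filter_upwards [eventually_gt_atTop 0] with x hx
    rw [mul_div_assoc, Real.sqrt_div_self', one_div]
  have hlow := (tendsto_sum_residueClass_div ha).sub h0
  rw [sub_zero] at hlow
  refine tendsto_of_tendsto_of_tendsto_of_le_of_le' hlow (tendsto_sum_residueClass_div ha) ?_ ?_
  · filter_upwards [eventually_gt_atTop 0] with x hx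
    rw [← sub_div]
    refine div_le_div_of_nonneg_right ?_ hx.le
    rw [sub_le_comm]
    refine le_trans ?_ (hC x)
    rw [Chebyshev.psi, Chebyshev.theta, primeTheta, Finset.sum_filter, ← Finset.sum_sub_distrib,
      ← Finset.sum_sub_distrib]
    refine Finset.sum_le_sum fun n _ => ?_
    by_cases hp : n.Prime
    · by_cases hn : (n : ZMod q) = a <;> simp [residueClass, hp, hn, vonMangoldt_apply_prime hp]
    · have := residueClass_le a n
      simpa [hp] using this
  · filter_upwards [eventually_gt_atTop 0] with x hx
    refine div_le_div_of_nonneg_right (Finset.sum_le_sum fun n _ => ?_) hx.le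
    split_ifs with h
    · rw [← vonMangoldt_apply_prime h.1, residueClass, indicator_of_mem (by exact h.2)]
    · exact residueClass_nonneg a n

theorem tendsto_primeTheta_one_mod_three :
    Tendsto (fun x : ℝ => primeTheta (fun p => p % 3 = 1) x / x) atTop (𝓝 (1 / 2)) := by
  have h := tendsto_primeTheta_residue (q := 3) (a := ((1 : ℕ) : ZMod 3)) (by simp)
  simp_rw [ZMod.natCast_eq_natCast_iff'] at h
  convert h using 2
  rw [show Nat.totient 3 = 2 from rfl]; norm_num

theorem tendsto_primeTheta_two_five_mod_nine :
    Tendsto (fun x : ℝ => primeTheta (fun p => p % 9 = 2 ∨ p % 9 = 5) x / x) atTop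
      (𝓝 (1 / 3)) := by
  have h2 := tendsto_primeTheta_residue (q := 9) (a := ((2 : ℕ) : ZMod 9))
    ((ZMod.isUnit_iff_coprime _ _).2 (by decide))
  have h5 := tendsto_primeTheta_residue (q := 9) (a := ((5 : ℕ) : ZMod 9))
    ((ZMod.isUnit_iff_coprime _ _).2 (by decide))
  simp_rw [ZMod.natCast_eq_natCast_iff'] at h2 h5
  have h := h2.add h5
  rw [show Nat.totient 9 = 6 by decide] at h
  convert h using 2 with x
  · rw [← add_div, primeTheta, primeTheta, primeTheta, ← Finset.sum_add_distrib]
    congr 1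
    refine Finset.sum_congr rfl fun n _ => ?_
    by_cases hp : n.Prime
    · by_cases h2 : n % 9 = 2
      · simp [hp, h2]
      · simp [hp, h2]
    · simp [hp]
  · norm_num

end PrimeTheta

section Mertens

open Set Topology MeasureTheory

/-- A continuous form of the Stolz-Cesàro theorem. -/
theorem tendsto_integral_mul_div_of_tendsto {h k K : ℝ → ℝ} {a A : ℝ}
    (hK : ∀ t, a ≤ t → HasDerivAt K (k t) t) (hk : ContinuousOn k (Ici a))
    (hk0 : ∀ t, a ≤ t → 0 ≤ k t) (hKlim : Tendsto K atTop atTop) (hh : Tendsto h atTop (𝓝 A))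
    (h_int : ∀ x, a ≤ x → IntervalIntegrable (fun t => h t * k t) volume a x) :
    Tendsto (fun x => (∫ t in a..x, h t * k t) / K x) atTop (𝓝 A) := by
  have hki : ∀ x y, a ≤ x → x ≤ y → IntervalIntegrable k volume x y := fun x y hx hxy =>
    (hk.mono fun t ht => hx.trans ht.1).intervalIntegrable_of_Icc hxy
  have hkK : ∀ x y, a ≤ x → x ≤ y → ∫ t in x..y, k t = K y - K x := fun x y hx hxy =>
    intervalIntegral.integral_eq_sub_of_hasDerivAt
      (fun t ht => hK t (hx.trans (by rw [uIcc_of_le hxy] at ht; exact ht.1))) (hki x y hx hxy)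
  rw [Metric.tendsto_atTop]
  intro ε hε
  obtain ⟨t₀, ht₀⟩ := Metric.tendsto_atTop.1 hh (ε / 2) (by linarith)
  set b := max a t₀ with hb
  set D := |(∫ t in a..b, h t * k t) - A * K b| + ε / 2 * |K b| with hD
  have hev : ∀ᶠ x in atTop, D < ε / 2 * K x :=
    (hKlim.const_mul_atTop (by linarith : 0 < ε / 2)).eventually_gt_atTop D
  obtain ⟨N, hN⟩ := eventually_atTop.1 (hev.and ((hKlim.eventually_gt_atTop 0).and
    (eventually_ge_atTop b)))
  refine ⟨N, fun x hx => ?_⟩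
  obtain ⟨h1, h2, h3⟩ := hN x hx
  have hab : a ≤ b := le_max_left _ _
  have hsub : IntervalIntegrable (fun t => h t * k t) volume b x :=
    (h_int x (hab.trans h3)).mono_set (by
      rw [uIcc_of_le h3, uIcc_of_le (hab.trans h3)]; exact Icc_subset_Icc_left hab)
  have hsplit := intervalIntegral.integral_add_adjacent_intervals (h_int b hab) hsub
  have hbound : |∫ t in b..x, (h t * k t - A * k t)| ≤ ε / 2 * (K x - K b) := by
    rw [← hkK b x hab h3, ← intervalIntegral.integral_const_mul, ← Real.norm_eq_abs]
    refine intervalIntegral.norm_integral_le_of_norm_le h3 ?_ ((hki b x hab h3).const_mul _)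
    refine Eventually.of_forall fun t ht => ?_
    have hta : a ≤ t := hab.trans ht.1.le
    rw [← sub_mul, norm_mul, Real.norm_of_nonneg (hk0 t hta)]
    refine mul_le_mul_of_nonneg_right ?_ (hk0 t hta)
    have := ht₀ t ((le_max_right _ _).trans ht.1.le)
    rw [Real.dist_eq] at this
    exact this.le
  rw [intervalIntegral.integral_sub hsub ((hki b x hab h3).const_mul _),
    intervalIntegral.integral_const_mul, hkK b x hab h3] at hbound
  rw [Real.dist_eq, div_sub' h2.ne', abs_div, abs_of_pos h2, div_lt_iff₀ h2, ← hsplit]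
  have e1 : (∫ t in a..b, h t * k t) + (∫ t in b..x, h t * k t) - K x * A =
    ((∫ t in a..b, h t * k t) - A * K b) + ((∫ t in b..x, h t * k t) - A * (K x - K b)) := by ring
  rw [e1]
  refine (abs_add_le _ _).trans_lt ?_
  have e2 := mul_le_mul_of_nonneg_left (neg_abs_le (K b)) (by linarith : 0 ≤ ε / 2)
  linarith

theorem Finset.sum_Icc_zero_eq_sum_Icc_one {f : ℕ → ℝ} (hf : f 0 = 0) (N : ℕ) :
    ∑ n ∈ Finset.Icc 0 N, f n = ∑ n ∈ Finset.Icc 1 N, f n := by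
  rw [Finset.Icc_eq_cons_Ioc (Nat.zero_le N), Finset.sum_cons, hf, zero_add]
  rfl

theorem primeTheta_measurable (P : ℕ → Prop) : Measurable (primeTheta P) := by
  refine Monotone.measurable fun x y hxy => ?_
  refine Finset.sum_le_sum_of_subset_of_nonneg (Finset.Icc_subset_Icc_right (Nat.floor_mono hxy))
    fun n _ _ => ?_
  split_ifs <;> [exact Real.log_natCast_nonneg n; exact le_rfl]

open Classical in
/-- Mertens' theorem for a set of primes of positive density. -/
theorem tendsto_sum_inv_prime_div_log_log {P : ℕ → Prop} {A : ℝ}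
    (hP : Tendsto (fun x : ℝ => primeTheta P x / x) atTop (𝓝 A)) :
    Tendsto (fun x : ℝ => (∑ n ∈ Finset.Icc 1 ⌊x⌋₊, if n.Prime ∧ P n then (1 : ℝ) / n else 0) /
      Real.log (Real.log x)) atTop (𝓝 A) := by
  set c : ℕ → ℝ := fun n => if n.Prime ∧ P n then Real.log n else 0 with hc
  have hlog : ∀ t : ℝ, 2 ≤ t → 0 < Real.log t := fun t ht => Real.log_pos (by linarith)
  have hder : ∀ t : ℝ, 2 ≤ t → HasDerivAt (fun t : ℝ => (t * Real.log t)⁻¹)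
      (-(Real.log t + 1) / (t * Real.log t) ^ 2) t := fun t ht => by
    have h0 : t ≠ 0 := by linarith
    have h1 := ((hasDerivAt_id t).mul (Real.hasDerivAt_log h0)).inv
      (mul_ne_zero h0 (hlog t ht).ne')
    refine (h1.congr_deriv ?_)
    simp only [id, one_mul, Pi.mul_apply, mul_inv_cancel₀ h0]
  have hsumc : ∀ t : ℝ, ∑ n ∈ Finset.Icc 0 ⌊t⌋₊, c n = primeTheta P t := fun t => by
    rw [primeTheta, Finset.sum_Icc_zero_eq_sum_Icc_one (by simp [hc])]
  have hcont : ContinuousOn (fun t : ℝ => -(Real.log t + 1) / (t * Real.log t) ^ 2) (Ici 2) := by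
    intro t ht
    have h0 : t ≠ 0 := by have : (2 : ℝ) ≤ t := ht; linarith
    have h1 := (hlog t ht).ne'
    refine ContinuousAt.continuousWithinAt ?_
    have : (t * Real.log t) ^ 2 ≠ 0 := by positivity
    fun_prop (disch := assumption)
  have habel : ∀ x : ℝ, 2 ≤ x → ∑ n ∈ Finset.Icc 1 ⌊x⌋₊,
      (if n.Prime ∧ P n then (1 : ℝ) / n else 0) = primeTheta P x / x * (Real.log x)⁻¹ +
        ∫ t in (2 : ℝ)..x, (primeTheta P t / t * (1 + (Real.log t)⁻¹)) *
          ((Real.log t)⁻¹ * t⁻¹) := fun x hx => by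
    have h1 := sum_mul_eq_sub_integral_mul₁ c (f := fun t : ℝ => (t * Real.log t)⁻¹)
      (by simp [hc]) (by simp [hc]) x (fun t ht => (hder t ht.1).differentiableAt) (by
        refine ContinuousOn.integrableOn_Icc ((hcont.mono Icc_subset_Ici_self).congr
          fun t ht => (hder t ht.1).deriv))
    rw [Finset.sum_Icc_zero_eq_sum_Icc_one (by simp [hc]), hsumc] at h1
    have h2 : ∑ n ∈ Finset.Icc 1 ⌊x⌋₊, (if n.Prime ∧ P n then (1 : ℝ) / n else 0) =
        ∑ n ∈ Finset.Icc 1 ⌊x⌋₊, ((n : ℝ) * Real.log n)⁻¹ * c n := by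
      refine Finset.sum_congr rfl fun n _ => ?_
      by_cases hn : n.Prime ∧ P n
      · have hl : Real.log n ≠ 0 := (hlog n (by exact_mod_cast hn.1.two_le)).ne'
        simp only [hc, if_pos hn, mul_inv, one_div]
        rw [inv_mul_cancel_right₀ hl]
      · simp [hc, hn]
    rw [h2]
    rw [h1, sub_eq_add_neg, ← integral_neg, intervalIntegral.integral_of_le hx]
    congr 1
    · rw [mul_inv]; ring
    · refine setIntegral_congr_fun measurableSet_Ioc fun t ht => ?_
      have h0 : t ≠ 0 := by linarith [ht.1]
      have h3 := (hlog t ht.1.le).ne'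
      simp only [(hder t ht.1.le).deriv, hsumc]
      field_simp
  have hinvlog : Tendsto (fun x : ℝ => (Real.log x)⁻¹) atTop (𝓝 0) :=
    tendsto_inv_atTop_zero.comp Real.tendsto_log_atTop
  have hll : Tendsto (fun x : ℝ => Real.log (Real.log x)) atTop atTop :=
    Real.tendsto_log_atTop.comp Real.tendsto_log_atTop
  have hmain : Tendsto (fun x : ℝ => (∫ t in (2 : ℝ)..x,
      (primeTheta P t / t * (1 + (Real.log t)⁻¹)) * ((Real.log t)⁻¹ * t⁻¹)) /
        Real.log (Real.log x)) atTop (𝓝 A) := by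
    refine tendsto_integral_mul_div_of_tendsto (fun t ht => ?_) ?_ (fun t ht => ?_) hll ?_ ?_
    · have h0 : t ≠ 0 := by linarith
      exact (Real.hasDerivAt_log (hlog t ht).ne').comp t (Real.hasDerivAt_log h0)
    · intro t ht
      have h0 : t ≠ 0 := by have : (2 : ℝ) ≤ t := ht; linarith
      have h1 := (hlog t ht).ne'
      refine ContinuousAt.continuousWithinAt ?_
      fun_prop (disch := assumption)
    · have := hlog t ht
      have : 0 < t := by linarith
      positivity
    · simpa using hP.mul (hinvlog.const_add 1)
    · intro x hx
      rw [intervalIntegrable_iff_integrableOn_Ioc_of_le hx]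
      have hm := primeTheta_measurable P
      refine Measure.integrableOn_of_bounded (M := Real.log 4 * (1 + (Real.log 2)⁻¹) *
        ((Real.log 2)⁻¹ * 2⁻¹)) measure_Ioc_lt_top.ne
        (Measurable.aestronglyMeasurable (by fun_prop)) ?_
      refine (ae_restrict_iff' measurableSet_Ioc).2 (Eventually.of_forall fun t ht => ?_)
      have ht0 : 0 < t := by linarith [ht.1]
      have hl2 := hlog 2 le_rfl
      have hlt := hlog t ht.1.le
      have hll : Real.log 2 ≤ Real.log t := Real.log_le_log (by norm_num) ht.1.le
      have hθ := primeTheta_nonneg P t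
      rw [Real.norm_of_nonneg (by positivity)]
      have hb : primeTheta P t / t ≤ Real.log 4 := by
        rw [div_le_iff₀ ht0]; exact primeTheta_le P ht0.le
      have h4 : 0 ≤ Real.log 4 := Real.log_nonneg (by norm_num)
      have ht2 := ht.1.le
      gcongr
  have hfirst : Tendsto (fun x : ℝ => primeTheta P x / x * (Real.log x)⁻¹ /
      Real.log (Real.log x)) atTop (𝓝 0) := by
    simpa [div_eq_mul_inv] using (hP.mul hinvlog).mul (tendsto_inv_atTop_zero.comp hll)
  have := hfirst.add hmain
  rw [zero_add] at this
  refine this.congr' ?_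
  filter_upwards [eventually_ge_atTop 2] with x hx
  rw [habel x hx, add_div]

end Mertens

section Karamata

open Set Topology MeasureTheory

theorem integrableOn_rpow_mul_exp_mul_comp {g : ℝ → ℝ} (hg : Continuous g) :
    IntegrableOn (fun t : ℝ => Real.exp (-t) * t ^ ((1 : ℝ) / 2 - 1) * g (Real.exp (-t)))
      (Ioi 0) := by
  obtain ⟨M, hM⟩ := isCompact_Icc.exists_bound_of_continuousOn (s := Icc (0 : ℝ) 1) hg.continuousOn
  refine Integrable.mul_bdd (c := M) (Real.GammaIntegral_convergent (by norm_num))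
    (by fun_prop) ?_
  refine (ae_restrict_iff' measurableSet_Ioi).2 (Eventually.of_forall fun t ht => hM _ ?_)
  have ht : 0 < t := ht
  exact ⟨(Real.exp_pos _).le, Real.exp_le_one_iff.2 (by linarith)⟩

/-- The linear functional appearing in the limit of Karamata's theorem of order `1 / 2`. -/
noncomputable def gammaFunctional (g : ℝ → ℝ) : ℝ :=
  ∫ t in Ioi (0 : ℝ), Real.exp (-t) * t ^ ((1 : ℝ) / 2 - 1) * g (Real.exp (-t))

theorem gammaFunctional_pow (k : ℕ) :
    gammaFunctional (fun x => x ^ k) = √Real.pi * (√(k + 1 : ℝ))⁻¹ := by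
  have h := Real.integral_rpow_mul_exp_neg_mul_Ioi (a := 1 / 2) (r := k + 1) (by norm_num)
    (by positivity)
  rw [Real.Gamma_one_half_eq, ← Real.sqrt_eq_rpow, one_div (_ + 1 : ℝ), Real.sqrt_inv,
    mul_comm] at h
  rw [gammaFunctional, ← h]
  refine setIntegral_congr_fun measurableSet_Ioi fun t _ => ?_
  simp only [← Real.exp_nat_mul]
  rw [mul_comm (Real.exp (-t)), mul_assoc, ← Real.exp_add]
  congr 2
  ring

theorem gammaFunctional_add {f g : ℝ → ℝ} (hf : Continuous f) (hg : Continuous g) :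
    gammaFunctional (fun x => f x + g x) = gammaFunctional f + gammaFunctional g := by
  rw [gammaFunctional, gammaFunctional, gammaFunctional,
    ← integral_add (integrableOn_rpow_mul_exp_mul_comp hf) (integrableOn_rpow_mul_exp_mul_comp hg)]
  simp only [mul_add]

theorem gammaFunctional_const_mul (r : ℝ) (g : ℝ → ℝ) :
    gammaFunctional (fun x => r * g x) = r * gammaFunctional g := by
  rw [gammaFunctional, gammaFunctional, ← integral_const_mul]
  congr 1 with t
  ring

theorem gammaFunctional_mono {f g : ℝ → ℝ} (hf : Continuous f) (hg : Continuous g)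
    (h : ∀ x ∈ Icc (0 : ℝ) 1, f x ≤ g x) : gammaFunctional f ≤ gammaFunctional g := by
  refine setIntegral_mono_on (integrableOn_rpow_mul_exp_mul_comp hf)
    (integrableOn_rpow_mul_exp_mul_comp hg) measurableSet_Ioi fun t ht => ?_
  have ht : 0 < t := ht
  refine mul_le_mul_of_nonneg_left (h _ ⟨(Real.exp_pos _).le, Real.exp_le_one_iff.2 (by linarith)⟩)
    (by positivity)

theorem integral_rpow_neg_half {s : ℝ} (hs : 0 ≤ s) :
    ∫ t in Ioc 0 s, t ^ ((1 : ℝ) / 2 - 1) = 2 * √s := by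
  rw [← intervalIntegral.integral_of_le hs, integral_rpow (Or.inl (by norm_num)),
    Real.sqrt_eq_rpow]
  norm_num
  ring

theorem le_gammaFunctional {g : ℝ → ℝ} (hg : Continuous g) (hg0 : ∀ x ∈ Icc (0 : ℝ) 1, 0 ≤ g x)
    {s : ℝ} (hs : 0 ≤ s) (h : ∀ t ∈ Ioc 0 s, 1 ≤ Real.exp (-t) * g (Real.exp (-t))) :
    2 * √s ≤ gammaFunctional g := by
  rw [← integral_rpow_neg_half hs]
  refine le_trans (b := ∫ t in Ioc 0 s, Real.exp (-t) * t ^ ((1 : ℝ) / 2 - 1) *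
    g (Real.exp (-t))) ?_ ?_
  · refine setIntegral_mono_on ?_ ((integrableOn_rpow_mul_exp_mul_comp hg).mono_set
      Ioc_subset_Ioi_self) measurableSet_Ioc fun t ht => ?_
    · exact (intervalIntegrable_iff_integrableOn_Ioc_of_le hs).1
        (intervalIntegral.intervalIntegrable_rpow' (by norm_num))
    · have := mul_le_mul_of_nonneg_right (h t ht) (Real.rpow_nonneg ht.1.le ((1 : ℝ) / 2 - 1))
      linarith
  · refine setIntegral_mono_set (integrableOn_rpow_mul_exp_mul_comp hg) ?_
      Ioc_subset_Ioi_self.eventuallyLE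
    refine (ae_restrict_iff' measurableSet_Ioi).2 (Eventually.of_forall fun t ht => ?_)
    have ht : 0 < t := ht
    have := hg0 _ ⟨(Real.exp_pos (-t)).le, Real.exp_le_one_iff.2 (by linarith)⟩
    simp only [Pi.zero_apply]
    positivity

theorem gammaFunctional_le {g : ℝ → ℝ} (hg : Continuous g) {s : ℝ} (hs : 0 ≤ s)
    (h1 : ∀ t ∈ Ioc 0 s, Real.exp (-t) * g (Real.exp (-t)) ≤ 1)
    (h0 : ∀ t, s < t → g (Real.exp (-t)) = 0) : gammaFunctional g ≤ 2 * √s := by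
  rw [← integral_rpow_neg_half hs, gammaFunctional,
    setIntegral_eq_of_subset_of_forall_sdiff_eq_zero (s := Ioc 0 s) measurableSet_Ioi
      Ioc_subset_Ioi_self]
  · refine setIntegral_mono_on ((integrableOn_rpow_mul_exp_mul_comp hg).mono_set
      Ioc_subset_Ioi_self) ?_ measurableSet_Ioc fun t ht => ?_
    · exact (intervalIntegrable_iff_integrableOn_Ioc_of_le hs).1
        (intervalIntegral.intervalIntegrable_rpow' (by norm_num))
    · have := mul_le_mul_of_nonneg_right (h1 t ht) (Real.rpow_nonneg ht.1.le ((1 : ℝ) / 2 - 1))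
      linarith
  · rintro t ⟨ht0, ht1⟩
    rw [h0 t (by by_contra! h; exact ht1 ⟨ht0, h⟩), mul_zero]

end Karamata

section KaramataMain

open Set Topology MeasureTheory

theorem exp_neg_mem_Icc {t : ℝ} (ht : 0 ≤ t) : Real.exp (-t) ∈ Icc (0 : ℝ) 1 :=
  ⟨(Real.exp_pos _).le, Real.exp_le_one_iff.2 (by linarith)⟩

variable {a l : ℕ → ℝ} {c : ℝ}

theorem summable_mul_exp_mul_comp (hl : ∀ n, 0 ≤ l n)
    (hsum : ∀ σ : ℝ, 0 < σ → Summable fun n => a n * Real.exp (-(σ * l n)))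
    {g : ℝ → ℝ} (hg : Continuous g) {σ : ℝ} (hσ : 0 < σ) :
    Summable fun n => a n * Real.exp (-(σ * l n)) * g (Real.exp (-(σ * l n))) := by
  obtain ⟨M, hM⟩ := isCompact_Icc.exists_bound_of_continuousOn (s := Icc (0 : ℝ) 1) hg.continuousOn
  refine Summable.of_norm_bounded ((hsum σ hσ).norm.mul_right M) fun n => ?_
  rw [norm_mul]
  exact mul_le_mul_of_nonneg_left (hM _ (exp_neg_mem_Icc (mul_nonneg hσ.le (hl n))))
    (norm_nonneg _)

theorem tendsto_tsum_polynomial (hl : ∀ n, 0 ≤ l n)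
    (hsum : ∀ σ : ℝ, 0 < σ → Summable fun n => a n * Real.exp (-(σ * l n)))
    (hlim : Tendsto (fun σ => √σ * ∑' n, a n * Real.exp (-(σ * l n))) (𝓝[>] 0) (𝓝 c))
    (q : Polynomial ℝ) :
    Tendsto (fun σ => √σ * ∑' n, a n * Real.exp (-(σ * l n)) * q.eval (Real.exp (-(σ * l n))))
      (𝓝[>] 0) (𝓝 (c / √Real.pi * gammaFunctional fun x => q.eval x)) := by
  induction q using Polynomial.induction_on' with
  | add p q hp hq =>
    have h := hp.add hq
    rw [← mul_add, ← gammaFunctional_add p.continuous q.continuous] at h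
    simp_rw [Polynomial.eval_add]
    refine h.congr' ?_
    filter_upwards [self_mem_nhdsWithin] with σ hσ
    rw [← mul_add, ← (summable_mul_exp_mul_comp hl hsum p.continuous hσ).tsum_add
      (summable_mul_exp_mul_comp hl hsum q.continuous hσ)]
    simp only [mul_add]
  | monomial k r =>
    have hk : (0 : ℝ) < k + 1 := by positivity
    have h1 : Tendsto (fun σ : ℝ => (k + 1) * σ) (𝓝[>] 0) (𝓝[>] 0) := by
      refine tendsto_nhdsWithin_iff.2 ⟨?_, ?_⟩
      · have : Continuous fun σ : ℝ => (k + 1) * σ := by fun_prop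
        exact (this.tendsto' 0 0 (by simp)).mono_left nhdsWithin_le_nhds
      · filter_upwards [self_mem_nhdsWithin] with σ hσ
        exact mul_pos hk hσ
    have h := ((hlim.comp h1).const_mul (√(k + 1 : ℝ))⁻¹).const_mul r
    simp_rw [Polynomial.eval_monomial]
    rw [gammaFunctional_const_mul, gammaFunctional_pow]
    have hpi : √Real.pi ≠ 0 := (Real.sqrt_pos.2 Real.pi_pos).ne'
    have h2 : r * ((√(k + 1 : ℝ))⁻¹ * c) =
        c / √Real.pi * (r * (√Real.pi * (√(k + 1 : ℝ))⁻¹)) := by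
      field_simp
    rw [h2] at h
    refine h.congr fun σ => ?_
    · simp only [Function.comp]
      rw [Real.sqrt_mul hk.le, mul_assoc (√(k + 1 : ℝ)),
        inv_mul_cancel_left₀ (Real.sqrt_pos.2 hk).ne', mul_left_comm]
      rw [← tsum_mul_left]
      congr 1
      refine tsum_congr fun n => ?_
      rw [show -((k + 1) * σ * l n) = -(σ * l n) + k * (-(σ * l n)) by ring, Real.exp_add,
        Real.exp_nat_mul]
      ring

theorem tsum_mul_exp_mono (ha : ∀ n, 0 ≤ a n) (hl : ∀ n, 0 ≤ l n)
    (hsum : ∀ σ : ℝ, 0 < σ → Summable fun n => a n * Real.exp (-(σ * l n)))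
    {f g : ℝ → ℝ} (hf : Continuous f) (hg : Continuous g) (hfg : ∀ x ∈ Icc (0 : ℝ) 1, f x ≤ g x)
    {σ : ℝ} (hσ : 0 < σ) :
    √σ * ∑' n, a n * Real.exp (-(σ * l n)) * f (Real.exp (-(σ * l n))) ≤
      √σ * ∑' n, a n * Real.exp (-(σ * l n)) * g (Real.exp (-(σ * l n))) := by
  refine mul_le_mul_of_nonneg_left (Summable.tsum_le_tsum (fun n => ?_)
    (summable_mul_exp_mul_comp hl hsum hf hσ) (summable_mul_exp_mul_comp hl hsum hg hσ))
    (Real.sqrt_nonneg _)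
  exact mul_le_mul_of_nonneg_left (hfg _ (exp_neg_mem_Icc (mul_nonneg hσ.le (hl n))))
    (mul_nonneg (ha n) (Real.exp_pos _).le)

theorem tendsto_tsum_continuous (ha : ∀ n, 0 ≤ a n) (hl : ∀ n, 0 ≤ l n)
    (hsum : ∀ σ : ℝ, 0 < σ → Summable fun n => a n * Real.exp (-(σ * l n))) (hc : 0 ≤ c)
    (hlim : Tendsto (fun σ => √σ * ∑' n, a n * Real.exp (-(σ * l n))) (𝓝[>] 0) (𝓝 c))
    {g : ℝ → ℝ} (hg : Continuous g) :
    Tendsto (fun σ => √σ * ∑' n, a n * Real.exp (-(σ * l n)) * g (Real.exp (-(σ * l n))))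
      (𝓝[>] 0) (𝓝 (c / √Real.pi * gammaFunctional g)) := by
  have hcpi : 0 ≤ c / √Real.pi := div_nonneg hc (Real.sqrt_nonneg _)
  have hG1 : gammaFunctional (fun _ => (1 : ℝ)) = √Real.pi := by
    simpa using gammaFunctional_pow 0
  have hpi : √Real.pi ≠ 0 := (Real.sqrt_pos.2 Real.pi_pos).ne'
  have approx : ∀ ε > 0, ∃ p q : Polynomial ℝ, (∀ x ∈ Icc (0 : ℝ) 1, p.eval x ≤ g x) ∧
      (∀ x ∈ Icc (0 : ℝ) 1, g x ≤ q.eval x) ∧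
      c / √Real.pi * gammaFunctional g - ε ≤ c / √Real.pi * gammaFunctional (fun x => p.eval x) ∧
      c / √Real.pi * gammaFunctional (fun x => q.eval x) ≤
        c / √Real.pi * gammaFunctional g + ε := by
    intro ε hε
    set η := ε / (2 * (c + 1)) with hη
    have hη0 : 0 < η := by positivity
    have hηc : 2 * η * c ≤ ε := by
      rw [hη, div_eq_mul_inv]
      have : (c + 1)⁻¹ * c ≤ 1 := by
        rw [inv_mul_le_iff₀ (by linarith)]; linarith
      calc 2 * (ε * (2 * (c + 1))⁻¹) * c = ε * ((c + 1)⁻¹ * c) := by rw [mul_inv]; ring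
        _ ≤ ε * 1 := mul_le_mul_of_nonneg_left this hε.le
        _ = ε := mul_one ε
    obtain ⟨p, hp⟩ := exists_polynomial_near_of_continuousOn 0 1 g hg.continuousOn η hη0
    have hcη : ∀ r : ℝ, Continuous fun x : ℝ => g x + r * 1 := fun r => by fun_prop
    have hgam : ∀ r : ℝ, c / √Real.pi * gammaFunctional (fun x => g x + r * 1) =
        c / √Real.pi * gammaFunctional g + r * c := fun r => by
      rw [gammaFunctional_add hg (by fun_prop), gammaFunctional_const_mul, hG1]
      field_simp
    refine ⟨p - Polynomial.C η, p + Polynomial.C η, fun x hx => ?_, fun x hx => ?_, ?_, ?_⟩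
    · have := abs_lt.1 (hp x hx)
      simp only [Polynomial.eval_sub, Polynomial.eval_C]; linarith
    · have := abs_lt.1 (hp x hx)
      simp only [Polynomial.eval_add, Polynomial.eval_C]; linarith
    · refine le_trans ?_ (mul_le_mul_of_nonneg_left (gammaFunctional_mono (hcη (-(2 * η)))
        (Polynomial.continuous _) fun x hx => ?_) hcpi)
      · rw [hgam]; linarith
      · have := abs_lt.1 (hp x hx)
        simp only [Polynomial.eval_sub, Polynomial.eval_C]; linarith
    · refine le_trans (mul_le_mul_of_nonneg_left (gammaFunctional_mono
        (Polynomial.continuous _) (hcη (2 * η)) fun x hx => ?_) hcpi) ?_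
      · have := abs_lt.1 (hp x hx)
        simp only [Polynomial.eval_add, Polynomial.eval_C]; linarith
      · rw [hgam]; linarith
  refine tendsto_order.2 ⟨fun b hb => ?_, fun b hb => ?_⟩
  · obtain ⟨p, q, h1, h2, h3, h4⟩ := approx ((c / √Real.pi * gammaFunctional g - b) / 2)
      (by linarith)
    have h5 := (tendsto_tsum_polynomial hl hsum hlim p).eventually_const_lt
      (show b < _ by linarith)
    filter_upwards [h5, self_mem_nhdsWithin] with σ hσ hσ0
    exact hσ.trans_le (tsum_mul_exp_mono ha hl hsum p.continuous hg h1 hσ0)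
  · obtain ⟨p, q, h1, h2, h3, h4⟩ := approx ((b - c / √Real.pi * gammaFunctional g) / 2)
      (by linarith)
    have h5 := (tendsto_tsum_polynomial hl hsum hlim q).eventually_lt_const
      (show _ < b by linarith)
    filter_upwards [h5, self_mem_nhdsWithin] with σ hσ hσ0
    exact (tsum_mul_exp_mono ha hl hsum hg q.continuous h2 hσ0).trans_lt hσ

/-- A continuous approximation of `x ↦ 1 / x` cut off to `[exp (-s), ∞)`. -/
noncomputable def rampInv (s t x : ℝ) : ℝ :=
  max 0 (min 1 ((x - Real.exp (-t)) / (Real.exp (-s) - Real.exp (-t)))) / max x (Real.exp (-t))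

theorem continuous_rampInv (s t : ℝ) : Continuous (rampInv s t) := by
  refine Continuous.div (by fun_prop) (by fun_prop) fun x => ?_
  exact (lt_max_of_lt_right (Real.exp_pos _)).ne'

theorem rampInv_nonneg (s t x : ℝ) : 0 ≤ rampInv s t x :=
  div_nonneg (le_max_left _ _) (le_max_of_le_right (Real.exp_pos _).le)

theorem rampInv_mul_le (s t : ℝ) {x : ℝ} (hx : 0 ≤ x) : x * rampInv s t x ≤ 1 := by
  have h : 0 < max x (Real.exp (-t)) := lt_max_of_lt_right (Real.exp_pos _)
  rw [rampInv, mul_div_assoc', div_le_one h]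
  refine le_trans (mul_le_of_le_one_right hx ?_) (le_max_left _ _)
  exact max_le zero_le_one (min_le_left _ _)

theorem rampInv_eq_zero {s t x : ℝ} (hst : s < t) (hx : x ≤ Real.exp (-t)) :
    rampInv s t x = 0 := by
  have h : 0 < Real.exp (-s) - Real.exp (-t) := by
    rw [sub_pos, Real.exp_lt_exp]; linarith
  rw [rampInv, max_eq_left, zero_div]
  exact (min_le_right _ _).trans (div_nonpos_of_nonpos_of_nonneg (by linarith) h.le)

theorem rampInv_mul_eq_one {s t x : ℝ} (hst : s < t) (hx : Real.exp (-s) ≤ x) :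
    x * rampInv s t x = 1 := by
  have h : 0 < Real.exp (-s) - Real.exp (-t) := by
    rw [sub_pos, Real.exp_lt_exp]; linarith
  have hx0 : 0 < x := (Real.exp_pos _).trans_le hx
  rw [rampInv, min_eq_left ((one_le_div h).2 (by linarith)), max_eq_right zero_le_one,
    max_eq_left (by linarith), mul_one_div_cancel hx0.ne']

/-- Karamata's Tauberian theorem of order `1 / 2`. -/
theorem tendsto_tsum_div_sqrt_of_laplace (ha : ∀ n, 0 ≤ a n) (hl : ∀ n, 0 ≤ l n)
    (hsum : ∀ σ : ℝ, 0 < σ → Summable fun n => a n * Real.exp (-(σ * l n))) (hc : 0 ≤ c)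
    (hlim : Tendsto (fun σ => √σ * ∑' n, a n * Real.exp (-(σ * l n))) (𝓝[>] 0) (𝓝 c)) :
    Tendsto (fun u => (∑' n, if l n ≤ u then a n else 0) / √u) atTop
      (𝓝 (2 * c / √Real.pi)) := by
  have hcpi : 0 ≤ c / √Real.pi := div_nonneg hc (Real.sqrt_nonneg _)
  have hinv : Tendsto (fun u : ℝ => u⁻¹) atTop (𝓝[>] 0) := tendsto_inv_atTop_nhdsGT_zero
  have hsm : ∀ u : ℝ, 0 < u → Summable fun n => if l n ≤ u then a n else 0 := fun u hu => by
    refine Summable.of_nonneg_of_le (fun n => ?_) (fun n => ?_)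
      ((hsum u⁻¹ (inv_pos.2 hu)).mul_left (Real.exp 1))
    · split_ifs <;> [exact ha n; exact le_rfl]
    · split_ifs with h
      · rw [mul_left_comm, ← Real.exp_add]
        refine le_mul_of_one_le_right (ha n) (Real.one_le_exp ?_)
        have : u⁻¹ * l n ≤ 1 := by rw [inv_mul_le_iff₀ hu]; linarith
        linarith
      · exact mul_nonneg (Real.exp_pos _).le (mul_nonneg (ha n) (Real.exp_pos _).le)
  have hlow : ∀ s : ℝ, 0 < s → s < 1 → ∀ᶠ u in atTop,
      √u⁻¹ * ∑' n, a n * Real.exp (-(u⁻¹ * l n)) * rampInv s 1 (Real.exp (-(u⁻¹ * l n))) ≤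
        (∑' n, if l n ≤ u then a n else 0) / √u := by
    intro s hs hs1
    filter_upwards [eventually_gt_atTop 0] with u hu
    rw [Real.sqrt_inv, inv_mul_eq_div]
    refine div_le_div_of_nonneg_right (Summable.tsum_le_tsum (fun n => ?_)
      (summable_mul_exp_mul_comp hl hsum (continuous_rampInv s 1) (inv_pos.2 hu)) (hsm u hu))
      (Real.sqrt_nonneg _)
    rw [mul_assoc]
    split_ifs with h
    · exact mul_le_of_le_one_right (ha n) (rampInv_mul_le _ _ (Real.exp_pos _).le)
    · rw [rampInv_eq_zero hs1, mul_zero, mul_zero]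
      refine Real.exp_le_exp.2 (neg_le_neg ?_)
      rw [le_inv_mul_iff₀ hu]; linarith
  have hup : ∀ s : ℝ, 1 < s → ∀ᶠ u in atTop, (∑' n, if l n ≤ u then a n else 0) / √u ≤
      √u⁻¹ * ∑' n, a n * Real.exp (-(u⁻¹ * l n)) * rampInv 1 s (Real.exp (-(u⁻¹ * l n))) := by
    intro s hs
    filter_upwards [eventually_gt_atTop 0] with u hu
    rw [Real.sqrt_inv, inv_mul_eq_div]
    refine div_le_div_of_nonneg_right (Summable.tsum_le_tsum (fun n => ?_) (hsm u hu)
      (summable_mul_exp_mul_comp hl hsum (continuous_rampInv 1 s) (inv_pos.2 hu)))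
      (Real.sqrt_nonneg _)
    split_ifs with h
    · rw [mul_assoc, rampInv_mul_eq_one hs, mul_one]
      refine Real.exp_le_exp.2 (neg_le_neg ?_)
      rw [inv_mul_le_iff₀ hu]; linarith
    · exact mul_nonneg (mul_nonneg (ha n) (Real.exp_pos _).le) (rampInv_nonneg _ _ _)
  have hsq : ContinuousAt (fun s : ℝ => c / √Real.pi * (2 * √s)) 1 := by fun_prop
  have hsq1 : c / √Real.pi * (2 * √1) = 2 * c / √Real.pi := by rw [Real.sqrt_one]; ring
  refine tendsto_order.2 ⟨fun b hb => ?_, fun b hb => ?_⟩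
  · have h1 : ∀ᶠ s : ℝ in 𝓝[<] 1, b < c / √Real.pi * (2 * √s) :=
      (hsq.tendsto.mono_left nhdsWithin_le_nhds).eventually_const_lt (by rwa [hsq1])
    obtain ⟨s, hbs, hs⟩ := (h1.and (Ioo_mem_nhdsLT zero_lt_one)).exists
    have h2 : b < c / √Real.pi * gammaFunctional (rampInv s 1) := by
      refine hbs.trans_le (mul_le_mul_of_nonneg_left (le_gammaFunctional (continuous_rampInv _ _)
        (fun x _ => rampInv_nonneg _ _ _) hs.1.le fun t ht => ?_) hcpi)
      exact (rampInv_mul_eq_one hs.2 (Real.exp_le_exp.2 (by linarith [ht.2]))).ge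
    have h3 := ((tendsto_tsum_continuous ha hl hsum hc hlim (continuous_rampInv s 1)).comp
      hinv).eventually_const_lt h2
    filter_upwards [h3, hlow s hs.1 hs.2] with u hu1 hu2
    exact hu1.trans_le hu2
  · have h1 : ∀ᶠ s : ℝ in 𝓝[>] 1, c / √Real.pi * (2 * √s) < b :=
      (hsq.tendsto.mono_left nhdsWithin_le_nhds).eventually_lt_const (by rwa [hsq1])
    obtain ⟨s, hbs, hs⟩ := (h1.and self_mem_nhdsWithin).exists
    have hs : 1 < s := hs
    have h2 : c / √Real.pi * gammaFunctional (rampInv 1 s) < b := by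
      refine (mul_le_mul_of_nonneg_left (gammaFunctional_le (continuous_rampInv _ _)
        (by linarith) (fun t _ => rampInv_mul_le _ _ (Real.exp_pos _).le)
        fun t ht => rampInv_eq_zero hs (Real.exp_le_exp.2 (by linarith))) hcpi).trans_lt hbs
    have h3 := ((tendsto_tsum_continuous ha hl hsum hc hlim (continuous_rampInv 1 s)).comp
      hinv).eventually_lt_const h2
    filter_upwards [h3, hup s hs] with u hu1 hu2
    exact hu2.trans_lt hu1

end KaramataMain

section EulerFactors

open Set Topology

/-- All prime divisors of `n` are congruent to `1` modulo `3`. -/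
def PrimesOneModThree (n : ℕ) : Prop := ∀ p : ℕ, p.Prime → p ∣ n → p % 3 = 1

theorem primesOneModThree_one : PrimesOneModThree 1 := fun _ hp h =>
  absurd (Nat.dvd_one.1 h) hp.ne_one

theorem not_primesOneModThree_zero : ¬ PrimesOneModThree 0 := fun h => by
  simpa using h 2 Nat.prime_two (dvd_zero _)

theorem primesOneModThree_mul {m n : ℕ} :
    PrimesOneModThree (m * n) ↔ PrimesOneModThree m ∧ PrimesOneModThree n :=
  ⟨fun h => ⟨fun p hp hd => h p hp (hd.mul_right n), fun p hp hd => h p hp (hd.mul_left m)⟩,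
    fun h p hp hd => (hp.dvd_mul.1 hd).elim (h.1 p hp) (h.2 p hp)⟩

theorem primesOneModThree_prime {p : ℕ} (hp : p.Prime) : PrimesOneModThree p ↔ p % 3 = 1 :=
  ⟨fun h => h p hp dvd_rfl, fun h q hq hd => by rwa [(Nat.prime_dvd_prime_iff_eq hq hp).1 hd]⟩

open Classical in
/-- The indicator of the integers all of whose prime divisors are congruent to `1` modulo `3`. -/
noncomputable def oneModThreeIndicator : ℕ →*₀ ℝ where
  toFun n := if PrimesOneModThree n then 1 else 0
  map_zero' := if_neg not_primesOneModThree_zero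
  map_one' := if_pos primesOneModThree_one
  map_mul' m n := by
    by_cases hm : PrimesOneModThree m <;> by_cases hn : PrimesOneModThree n <;>
      simp [primesOneModThree_mul, hm, hn]

open Classical in
theorem oneModThreeIndicator_apply (n : ℕ) :
    oneModThreeIndicator n = if PrimesOneModThree n then 1 else 0 := rfl

/-- The quadratic character modulo `3`, with real values. -/
noncomputable def chiThree : ℕ →*₀ ℝ where
  toFun n := if n % 3 = 1 then 1 else if n % 3 = 2 then -1 else 0
  map_zero' := by simp
  map_one' := by simp
  map_mul' m n := by
    have hm : m % 3 < 3 := Nat.mod_lt _ (by norm_num)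
    have hn : n % 3 < 3 := Nat.mod_lt _ (by norm_num)
    rw [Nat.mul_mod]
    generalize m % 3 = a at *
    generalize n % 3 = b at *
    interval_cases a <;> interval_cases b <;> norm_num

theorem chiThree_apply (n : ℕ) :
    chiThree n = if n % 3 = 1 then 1 else if n % 3 = 2 then -1 else 0 := rfl

/-- The function `n ↦ n ^ (-s)` as a monoid homomorphism. -/
noncomputable def rpowNegHom (s : ℝ) (hs : s ≠ 0) : ℕ →*₀ ℝ where
  toFun n := (n : ℝ) ^ (-s)
  map_zero' := by simp [Real.zero_rpow (neg_ne_zero.2 hs)]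
  map_one' := by simp
  map_mul' m n := by
    push_cast
    exact Real.mul_rpow (Nat.cast_nonneg _) (Nat.cast_nonneg _)

open Classical in
/-- The indicator of the squarefree integers all of whose prime divisors are congruent to `1`
modulo `3`. -/
noncomputable def sqfreeOneModThree (n : ℕ) : ℝ :=
  if Squarefree n ∧ PrimesOneModThree n then 1 else 0

theorem sqfreeOneModThree_nonneg (n : ℕ) : 0 ≤ sqfreeOneModThree n := by
  unfold sqfreeOneModThree; split_ifs <;> norm_num

theorem sqfreeOneModThree_le_one (n : ℕ) : sqfreeOneModThree n ≤ 1 := by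
  unfold sqfreeOneModThree; split_ifs <;> norm_num

theorem sqfreeOneModThree_zero : sqfreeOneModThree 0 = 0 := by
  simp [sqfreeOneModThree]

theorem sqfreeOneModThree_one : sqfreeOneModThree 1 = 1 := by
  simp [sqfreeOneModThree, primesOneModThree_one]

theorem sqfreeOneModThree_mul {m n : ℕ} (h : m.Coprime n) :
    sqfreeOneModThree (m * n) = sqfreeOneModThree m * sqfreeOneModThree n := by
  have hs := Nat.squarefree_mul h
  have hp := primesOneModThree_mul (m := m) (n := n)
  unfold sqfreeOneModThree
  by_cases h1 : Squarefree m <;> by_cases h2 : Squarefree n <;>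
    by_cases h3 : PrimesOneModThree m <;> by_cases h4 : PrimesOneModThree n <;>
    simp only [h1, h2, h3, h4, and_self, and_true, and_false] at hs hp <;>
    simp [hs, hp, h1, h2, h3, h4]

theorem sqfreeOneModThree_prime {p : ℕ} (hp : p.Prime) :
    sqfreeOneModThree p = if p % 3 = 1 then 1 else 0 := by
  simp [sqfreeOneModThree, hp.prime.squarefree, primesOneModThree_prime hp]

theorem sqfreeOneModThree_pow {p : ℕ} (hp : p.Prime) {e : ℕ} (he : 2 ≤ e) :
    sqfreeOneModThree (p ^ e) = 0 := by
  refine if_neg fun h => ?_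
  have := (Nat.squarefree_pow_iff hp.ne_one (by omega)).1 h.1
  omega

theorem summable_rpow_neg {s : ℝ} (hs : 1 < s) : Summable fun n : ℕ => (n : ℝ) ^ (-s) :=
  Real.summable_nat_rpow.2 (by linarith)

theorem summable_mul_rpow_neg {a : ℕ → ℝ} (ha : ∀ n, |a n| ≤ 1) {s : ℝ} (hs : 1 < s) :
    Summable fun n : ℕ => ‖a n * (n : ℝ) ^ (-s)‖ := by
  refine Summable.of_nonneg_of_le (fun n => norm_nonneg _) (fun n => ?_) (summable_rpow_neg hs)
  rw [norm_mul, Real.norm_eq_abs, Real.norm_eq_abs,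
    abs_of_nonneg (Real.rpow_nonneg (Nat.cast_nonneg n) _)]
  exact mul_le_of_le_one_left (Real.rpow_nonneg (Nat.cast_nonneg n) _) (ha n)

theorem abs_sqfreeOneModThree_le (n : ℕ) : |sqfreeOneModThree n| ≤ 1 := by
  rw [abs_of_nonneg (sqfreeOneModThree_nonneg n)]; exact sqfreeOneModThree_le_one n

theorem abs_oneModThreeIndicator_le (n : ℕ) : |oneModThreeIndicator n| ≤ 1 := by
  rw [oneModThreeIndicator_apply]; split_ifs <;> simp

theorem abs_chiThree_le (n : ℕ) : |chiThree n| ≤ 1 := by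
  rw [chiThree_apply]; split_ifs <;> simp

theorem hasProd_sqfreeOneModThree {s : ℝ} (hs : 1 < s) :
    HasProd (fun p : Nat.Primes => 1 + (if (p : ℕ) % 3 = 1 then ((p : ℕ) : ℝ) ^ (-s) else 0))
      (∑' n : ℕ, sqfreeOneModThree n * (n : ℝ) ^ (-s)) := by
  have h := EulerProduct.eulerProduct_hasProd
    (f := fun n : ℕ => sqfreeOneModThree n * (n : ℝ) ^ (-s)) (by simp [sqfreeOneModThree_one])
    (fun {m n} hmn => by
      rw [sqfreeOneModThree_mul hmn]
      push_cast
      rw [Real.mul_rpow (Nat.cast_nonneg _) (Nat.cast_nonneg _)]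
      ring)
    (summable_mul_rpow_neg abs_sqfreeOneModThree_le hs) (by simp [sqfreeOneModThree_zero])
  refine (congrArg (HasProd · _) (funext fun p => ?_)).mpr h
  rw [tsum_eq_sum (s := Finset.range 2)]
  · simp [Finset.sum_range_succ, sqfreeOneModThree_one, sqfreeOneModThree_prime p.2]
  · intro e he
    rw [sqfreeOneModThree_pow p.2 (by have := Finset.mem_range.not.1 he; omega), zero_mul]

theorem hasProd_mul_rpow_neg (a : ℕ →*₀ ℝ) (ha : ∀ n, |a n| ≤ 1) {s : ℝ} (hs : 1 < s) :
    HasProd (fun p : Nat.Primes => (1 - a p * ((p : ℕ) : ℝ) ^ (-s))⁻¹)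
      (∑' n : ℕ, a n * (n : ℝ) ^ (-s)) :=
  EulerProduct.eulerProduct_completely_multiplicative_hasProd
    (f := a * rpowNegHom s (by linarith)) (summable_mul_rpow_neg ha hs)

theorem hasProd_rpow_neg {s : ℝ} (hs : 1 < s) :
    HasProd (fun p : Nat.Primes => (1 - ((p : ℕ) : ℝ) ^ (-s))⁻¹) (∑' n : ℕ, (n : ℝ) ^ (-s)) :=
  EulerProduct.eulerProduct_completely_multiplicative_hasProd
    (f := rpowNegHom s (by linarith)) (summable_rpow_neg hs).norm

/-- The square of the generating Dirichlet series, expressed through `ζ`, `L(χ₃)` and a Dirichlet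
series converging near `s = 1`. -/
theorem sq_tsum_sqfreeOneModThree {s : ℝ} (hs : 1 < s) :
    (∑' n : ℕ, sqfreeOneModThree n * (n : ℝ) ^ (-s)) ^ 2 * (∑' n : ℕ, (n : ℝ) ^ (-(2 * s))) *
        (1 + (3 : ℝ) ^ (-s)) * (∑' n : ℕ, oneModThreeIndicator n * (n : ℝ) ^ (-(2 * s))) =
      (∑' n : ℕ, (n : ℝ) ^ (-s)) * ∑' n : ℕ, chiThree n * (n : ℝ) ^ (-s) := by
  have hb := hasProd_sqfreeOneModThree hs
  have h3 : HasProd (fun p : Nat.Primes => if (p : ℕ) = 3 then 1 + (3 : ℝ) ^ (-s) else 1)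
      (1 + (3 : ℝ) ^ (-s)) := by
    have := hasProd_single (f := fun p : Nat.Primes =>
      if (p : ℕ) = 3 then 1 + (3 : ℝ) ^ (-s) else 1) ⟨3, Nat.prime_three⟩ (fun p hp =>
        if_neg fun h => hp (Subtype.ext h))
    simpa using this
  have hl := ((((hb.mul hb).mul (hasProd_rpow_neg (s := 2 * s) (by linarith))).mul h3).mul
    (hasProd_mul_rpow_neg oneModThreeIndicator abs_oneModThreeIndicator_le
      (s := 2 * s) (by linarith)))
  have hr := (hasProd_rpow_neg hs).mul (hasProd_mul_rpow_neg chiThree abs_chiThree_le hs)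
  rw [sq]
  refine hl.unique ?_
  convert hr using 2 with p
  have hp := p.2
  have hu : ((p : ℕ) : ℝ) ^ (-(2 * s)) = (((p : ℕ) : ℝ) ^ (-s)) ^ 2 := by
    rw [← Real.rpow_natCast, ← Real.rpow_mul (Nat.cast_nonneg _)]
    congr 1
    push_cast
    ring
  have hu0 : 0 < ((p : ℕ) : ℝ) ^ (-s) := Real.rpow_pos_of_pos (by exact_mod_cast hp.pos) _
  have hu1 : ((p : ℕ) : ℝ) ^ (-s) < 1 :=
    Real.rpow_lt_one_of_one_lt_of_neg (by exact_mod_cast hp.one_lt) (by linarith)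
  have hu3 : (p : ℕ) = 3 → (3 : ℝ) ^ (-s) = ((p : ℕ) : ℝ) ^ (-s) := fun h => by simp [h]
  rw [hu, oneModThreeIndicator_apply, chiThree_apply, primesOneModThree_prime hp]
  generalize ((p : ℕ) : ℝ) ^ (-s) = u at *
  have h1 : 1 - u ≠ 0 := by linarith
  have h2 : 1 + u ≠ 0 := by linarith
  have h4 : 1 - u ^ 2 = (1 - u) * (1 + u) := by ring
  have hlt : (p : ℕ) % 3 < 3 := Nat.mod_lt _ (by norm_num)
  by_cases hp3 : (p : ℕ) = 3
  · rw [hu3 hp3]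
    simp only [hp3]
    norm_num
    rw [h4]
    field_simp
  · have hne : (p : ℕ) % 3 ≠ 0 := fun h =>
      hp3 ((Nat.prime_dvd_prime_iff_eq Nat.prime_three hp).1 (Nat.dvd_of_mod_eq_zero h)).symm
    obtain h | h : (p : ℕ) % 3 = 1 ∨ (p : ℕ) % 3 = 2 := by omega
    · simp only [h, hp3]
      norm_num
      rw [h4]
      field_simp
    · simp only [h, hp3]
      norm_num
      rw [h4]
      field_simp
end EulerFactors

section DirichletLimits

open Set Topology

theorem tendsto_tsum_mul_rpow_neg_two_mul {a : ℕ → ℝ} (ha : ∀ n, |a n| ≤ 1) :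
    Tendsto (fun s : ℝ => ∑' n : ℕ, a n * (n : ℝ) ^ (-(2 * s))) (𝓝[>] 1)
      (𝓝 (∑' n : ℕ, a n * (n : ℝ) ^ (-(2 : ℝ)))) := by
  refine tendsto_tsum_of_dominated_convergence
    (bound := fun n : ℕ => (n : ℝ) ^ (-(2 : ℝ))) (summable_rpow_neg one_lt_two) (fun n => ?_) ?_
  · rcases Nat.eq_zero_or_pos n with rfl | hn
    · refine Tendsto.congr' ?_ tendsto_const_nhds
      filter_upwards [self_mem_nhdsWithin] with s hs
      have : (1 : ℝ) < s := hs
      rw [Nat.cast_zero, Real.zero_rpow (by norm_num), Real.zero_rpow (by linarith)]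
    · refine Tendsto.mono_left ?_ nhdsWithin_le_nhds
      have : Continuous fun s : ℝ => a n * (n : ℝ) ^ (-(2 * s)) :=
        continuous_const.mul (Real.continuous_const_rpow (by positivity) |>.comp (by fun_prop))
      simpa using this.tendsto 1
  · filter_upwards [self_mem_nhdsWithin] with s hs n
    have hs' : (1 : ℝ) < s := hs
    rw [norm_mul, Real.norm_eq_abs, Real.norm_eq_abs,
      abs_of_nonneg (Real.rpow_nonneg (Nat.cast_nonneg n) _)]
    refine (mul_le_of_le_one_left (Real.rpow_nonneg (Nat.cast_nonneg n) _) (ha n)).trans ?_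
    rcases Nat.eq_zero_or_pos n with rfl | hn
    · rw [Nat.cast_zero, Real.zero_rpow (by linarith : -(2 * s) ≠ 0),
        Real.zero_rpow (by norm_num)]
    · exact Real.rpow_le_rpow_of_exponent_le (by exact_mod_cast hn) (by linarith)

theorem tsum_chiThree_mul {s : ℝ} (hs : 1 < s) :
    ∑' n : ℕ, chiThree n * (n : ℝ) ^ (-s) =
      ∑' m : ℕ, ((3 * m + 1 : ℝ) ^ (-s) - (3 * m + 2 : ℝ) ^ (-s)) := by
  have hsum : Summable fun n : ℕ => chiThree n * (n : ℝ) ^ (-s) :=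
    (summable_mul_rpow_neg abs_chiThree_le hs).of_norm
  have hinj : ∀ j : ℕ, Function.Injective fun m : ℕ => j + 3 * m := fun j a b h => by
    dsimp only at h
    omega
  have h1 : Summable fun m : ℕ => (3 * m + 1 : ℝ) ^ (-s) := by
    refine ((summable_rpow_neg hs).comp_injective (hinj 1)).congr fun m => ?_
    simp [add_comm]
  have h2 : Summable fun m : ℕ => (3 * m + 2 : ℝ) ^ (-s) := by
    refine ((summable_rpow_neg hs).comp_injective (hinj 2)).congr fun m => ?_
    simp [add_comm]
  rw [Nat.sumByResidueClasses hsum 3, h1.tsum_sub h2]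
  have e : (Finset.univ : Finset (ZMod 3)) = {0, 1, 2} := by decide
  rw [e, Finset.sum_insert (by decide), Finset.sum_insert (by decide), Finset.sum_singleton]
  have v0 : (0 : ZMod 3).val = 0 := rfl
  have v1 : (1 : ZMod 3).val = 1 := rfl
  have v2 : (2 : ZMod 3).val = 2 := rfl
  rw [v0, v1, v2]
  have c0 : ∀ m : ℕ, chiThree (3 * m) = 0 := fun m => by
    rw [chiThree_apply, if_neg (by omega), if_neg (by omega)]
  have c1 : ∀ m : ℕ, chiThree (1 + 3 * m) = 1 := fun m => by
    rw [chiThree_apply, if_pos (by omega)]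
  have c2 : ∀ m : ℕ, chiThree (2 + 3 * m) = -1 := fun m => by
    rw [chiThree_apply, if_neg (by omega), if_pos (by omega)]
  simp only [zero_add, c0, c1, c2, zero_mul, tsum_zero, one_mul, neg_mul, tsum_neg]
  push_cast
  simp only [add_comm, sub_eq_add_neg]

theorem rpow_neg_sub_le {a s : ℝ} (ha : 1 ≤ a) (hs : 1 ≤ s) (hs2 : s ≤ 2) :
    a ^ (-s) - (a + 1) ^ (-s) ≤ 2 / a ^ 2 := by
  have ha0 : 0 < a := by linarith
  have h1 : 1 + s * (-(1 / (a + 1))) ≤ (1 + -(1 / (a + 1))) ^ s :=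
    one_add_mul_self_le_rpow_one_add (by
      have : 1 / (a + 1) ≤ 1 := by rw [div_le_one (by linarith)]; linarith
      linarith) hs
  have h2 : (1 + -(1 / (a + 1))) = a * (a + 1)⁻¹ := by field_simp; ring
  have h3 : (a + 1) ^ (-s) = a ^ (-s) * (1 + -(1 / (a + 1))) ^ s := by
    rw [h2, Real.mul_rpow ha0.le (by positivity), Real.inv_rpow (by positivity),
      Real.rpow_neg (by positivity), Real.rpow_neg ha0.le]
    have := (Real.rpow_pos_of_pos ha0 s).ne'
    field_simp
  have h4 : a ^ (-s) ≤ a⁻¹ := by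
    rw [← Real.rpow_neg_one]
    exact Real.rpow_le_rpow_of_exponent_le ha (by linarith)
  have h5 : 0 < a ^ (-s) := Real.rpow_pos_of_pos ha0 _
  have h6 : 1 - (1 + -(1 / (a + 1))) ^ s ≤ 2 / a := by
    have : s * (1 / (a + 1)) ≤ 2 / a := by
      rw [mul_one_div]
      exact div_le_div₀ (by norm_num) hs2 ha0 (by linarith)
    linarith
  calc a ^ (-s) - (a + 1) ^ (-s) = a ^ (-s) * (1 - (1 + -(1 / (a + 1))) ^ s) := by rw [h3]; ring
    _ ≤ a ^ (-s) * (2 / a) := mul_le_mul_of_nonneg_left h6 h5.le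
    _ ≤ a⁻¹ * (2 / a) := mul_le_mul_of_nonneg_right h4 (by positivity)
    _ = 2 / a ^ 2 := by field_simp

theorem rpow_neg_sub_nonneg {a s : ℝ} (ha : 1 ≤ a) (hs : 1 ≤ s) :
    0 ≤ a ^ (-s) - (a + 1) ^ (-s) :=
  sub_nonneg.2 (Real.rpow_le_rpow_of_nonpos (by linarith) (by linarith) (by linarith))

theorem norm_rpow_neg_sub_le (m : ℕ) {s : ℝ} (hs : 1 ≤ s) (hs2 : s ≤ 2) :
    ‖(3 * m + 1 : ℝ) ^ (-s) - (3 * m + 2 : ℝ) ^ (-s)‖ ≤ 2 * (1 / ((m + 1 : ℕ) : ℝ) ^ 2) := by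
  have hm : (0 : ℝ) ≤ m := Nat.cast_nonneg m
  have h := rpow_neg_sub_le (a := 3 * m + 1) (by linarith) hs hs2
  have h0 := rpow_neg_sub_nonneg (a := 3 * m + 1) (by linarith) hs
  have e : (3 * m + 1 + 1 : ℝ) = 3 * m + 2 := by ring
  rw [e] at h h0
  rw [Real.norm_eq_abs, abs_of_nonneg h0, mul_one_div]
  refine h.trans (div_le_div_of_nonneg_left (by norm_num) (by positivity) ?_)
  push_cast
  exact pow_le_pow_left₀ (by linarith) (by linarith) 2

theorem summable_two_mul_inv_sq : Summable fun m : ℕ => 2 * (1 / ((m + 1 : ℕ) : ℝ) ^ 2) :=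
  ((summable_nat_add_iff 1).2 (Real.summable_one_div_nat_pow.2 one_lt_two)).mul_left 2

theorem tsum_chiThree_one :
    ∑' m : ℕ, ((3 * m + 1 : ℝ) ^ (-(1 : ℝ)) - (3 * m + 2 : ℝ) ^ (-(1 : ℝ))) =
      Real.pi / (3 * √3) := by
  have hsum : Summable fun m : ℕ => ((3 * m + 1 : ℝ) ^ (-(1 : ℝ)) - (3 * m + 2 : ℝ) ^ (-(1 : ℝ))) :=
    summable_two_mul_inv_sq.of_norm_bounded fun m => norm_rpow_neg_sub_le m le_rfl one_le_two
  set g : ℕ → ℝ := fun k => 1 / (3 * k + 4) - 1 / (3 * k + 2) with hg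
  have hgsum : Summable g := by
    refine summable_two_mul_inv_sq.of_norm_bounded fun k => ?_
    have hk : (0 : ℝ) ≤ k := Nat.cast_nonneg k
    have e : g k = -(2 / ((3 * k + 4) * (3 * k + 2))) := by
      rw [hg]
      field_simp
      ring
    rw [e, norm_neg, Real.norm_eq_abs, abs_of_nonneg (by positivity), mul_one_div]
    refine div_le_div_of_nonneg_left (by norm_num) (by positivity) ?_
    push_cast
    nlinarith
  have hcot := cot_series_rep (x := (1 / 3 : ℂ)) (by
    rintro ⟨n, hn⟩
    have h3 : (3 : ℂ) * n = 1 := by rw [hn]; norm_num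
    have h4 : (3 : ℤ) * n = 1 := by exact_mod_cast h3
    omega)
  rw [tsum_pnat_eq_tsum_succ (f := fun n : ℕ => 1 / ((1 / 3 : ℂ) - n) + 1 / ((1 / 3 : ℂ) + n))]
    at hcot
  have hterm : ∀ k : ℕ, 1 / ((1 / 3 : ℂ) - (k + 1 : ℕ)) + 1 / ((1 / 3 : ℂ) + (k + 1 : ℕ)) =
      ((3 * g k : ℝ) : ℂ) := by
    intro k
    have hk : (0 : ℝ) ≤ k := Nat.cast_nonneg k
    have hr : 1 / ((1 / 3 : ℝ) - (k + 1 : ℕ)) + 1 / ((1 / 3 : ℝ) + (k + 1 : ℕ)) = 3 * g k := by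
      have h1 : (1 / 3 : ℝ) - (k + 1 : ℕ) = -((3 * k + 2) / 3) := by push_cast; ring
      have h2 : (1 / 3 : ℝ) + (k + 1 : ℕ) = (3 * k + 4) / 3 := by push_cast; ring
      rw [h1, h2, hg]
      have h3 : (3 * k + 2 : ℝ) ≠ 0 := by positivity
      have h4 : (3 * k + 4 : ℝ) ≠ 0 := by positivity
      field_simp
      ring
    rw [← hr]
    push_cast
    ring
  simp only [hterm] at hcot
  rw [← Complex.ofReal_tsum, tsum_mul_left] at hcot
  have hc : (Real.pi : ℂ) * ((Real.pi : ℂ) * (1 / 3)).cot = ((Real.pi / √3 : ℝ) : ℂ) := by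
    have e : (Real.pi : ℂ) * (1 / 3) = ((Real.pi / 3 : ℝ) : ℂ) := by push_cast; ring
    rw [Complex.cot, e, ← Complex.ofReal_cos, ← Complex.ofReal_sin, Real.cos_pi_div_three,
      Real.sin_pi_div_three]
    push_cast
    field_simp
  rw [hc] at hcot
  have hreal : Real.pi / √3 = 3 + 3 * ∑' k, g k := by
    have h : ((Real.pi / √3 : ℝ) : ℂ) = ((3 + 3 * ∑' k, g k : ℝ) : ℂ) := by
      rw [hcot]
      push_cast
      norm_num
    exact_mod_cast h
  have hpart : ∀ N : ℕ, ∑ m ∈ Finset.range N,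
      ((3 * m + 1 : ℝ) ^ (-(1 : ℝ)) - (3 * m + 2 : ℝ) ^ (-(1 : ℝ))) =
      1 + (∑ k ∈ Finset.range N, g k) - 1 / (3 * N + 1) := by
    intro N
    induction N with
    | zero => simp
    | succ N ih =>
      rw [Finset.sum_range_succ, Finset.sum_range_succ, ih, hg, Real.rpow_neg_one,
        Real.rpow_neg_one]
      push_cast
      ring
  have hlim : Tendsto (fun N : ℕ => 1 + (∑ k ∈ Finset.range N, g k) - 1 / (3 * N + 1 : ℝ)) atTop
      (𝓝 (1 + (∑' k, g k) - 0)) := by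
    refine (hgsum.hasSum.tendsto_sum_nat.const_add 1).sub ?_
    refine tendsto_const_nhds.div_atTop ?_
    exact tendsto_atTop_add_const_right _ _
      (tendsto_natCast_atTop_atTop.const_mul_atTop (by norm_num))
  have hu := tendsto_nhds_unique (hsum.hasSum.tendsto_sum_nat.congr hpart) hlim
  rw [hu]
  have h3 : Real.pi / (3 * √3) = (Real.pi / √3) / 3 := by field_simp
  rw [h3, hreal]
  ring

theorem tendsto_tsum_chiThree :
    Tendsto (fun s : ℝ => ∑' n : ℕ, chiThree n * (n : ℝ) ^ (-s)) (𝓝[>] 1)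
      (𝓝 (Real.pi / (3 * √3))) := by
  rw [← tsum_chiThree_one]
  have h : Tendsto (fun s : ℝ => ∑' m : ℕ, ((3 * m + 1 : ℝ) ^ (-s) - (3 * m + 2 : ℝ) ^ (-s)))
      (𝓝[>] 1)
      (𝓝 (∑' m : ℕ, ((3 * m + 1 : ℝ) ^ (-(1 : ℝ)) - (3 * m + 2 : ℝ) ^ (-(1 : ℝ))))) := by
    refine tendsto_tsum_of_dominated_convergence summable_two_mul_inv_sq (fun m => ?_) ?_
    · refine Tendsto.mono_left ?_ nhdsWithin_le_nhds
      have h1 : Continuous fun s : ℝ => (3 * m + 1 : ℝ) ^ (-s) :=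
        Real.continuous_const_rpow (by positivity) |>.comp continuous_neg
      have h2 : Continuous fun s : ℝ => (3 * m + 2 : ℝ) ^ (-s) :=
        Real.continuous_const_rpow (by positivity) |>.comp continuous_neg
      exact (h1.sub h2).tendsto 1
    · filter_upwards [Ioo_mem_nhdsGT (show (1 : ℝ) < 2 by norm_num)] with s hs m
      exact norm_rpow_neg_sub_le m hs.1.le hs.2.le
  refine h.congr' ?_
  filter_upwards [self_mem_nhdsWithin] with s hs
  exact (tsum_chiThree_mul hs).symm

end DirichletLimits

section LandauConstant

open Set Topology

/-- The value at `2` of the Dirichlet series of the integers composed of primes congruent to `1`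
modulo `3`. -/
noncomputable def oneModThreeSeriesTwo : ℝ :=
  ∑' n : ℕ, oneModThreeIndicator n * (n : ℝ) ^ (-(2 : ℝ))

theorem oneModThreeSeriesTwo_pos : 0 < oneModThreeSeriesTwo := by
  have hs : Summable fun n : ℕ => oneModThreeIndicator n * (n : ℝ) ^ (-(2 : ℝ)) :=
    (summable_mul_rpow_neg abs_oneModThreeIndicator_le one_lt_two).of_norm
  refine hs.tsum_pos (fun n => mul_nonneg ?_ (Real.rpow_nonneg (Nat.cast_nonneg n) _)) 1 ?_
  · rw [oneModThreeIndicator_apply]; split_ifs <;> norm_num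
  · simp

theorem tendsto_sub_mul_sq_tsum :
    Tendsto (fun s : ℝ => (s - 1) * (∑' n : ℕ, sqfreeOneModThree n * (n : ℝ) ^ (-s)) ^ 2) (𝓝[>] 1)
      (𝓝 (√3 / (2 * Real.pi * oneModThreeSeriesTwo))) := by
  have hz1 : Tendsto (fun s : ℝ => (s - 1) * ∑' n : ℕ, (n : ℝ) ^ (-s)) (𝓝[>] 1) (𝓝 1) := by
    refine tendsto_sub_mul_tsum_nat_rpow.congr fun s => ?_
    simp only [one_div, Real.rpow_neg (Nat.cast_nonneg _)]
  have hz2 : Tendsto (fun s : ℝ => ∑' n : ℕ, (n : ℝ) ^ (-(2 * s))) (𝓝[>] 1)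
      (𝓝 (Real.pi ^ 2 / 6)) := by
    have h := tendsto_tsum_mul_rpow_neg_two_mul (a := fun _ => 1) (by simp)
    have e : ∑' n : ℕ, (1 : ℝ) * (n : ℝ) ^ (-(2 : ℝ)) = Real.pi ^ 2 / 6 := by
      rw [← hasSum_zeta_two.tsum_eq]
      refine tsum_congr fun n => ?_
      rw [one_mul, Real.rpow_neg (Nat.cast_nonneg _), one_div]
      norm_cast
    rw [e] at h
    simpa using h
  have hD := tendsto_tsum_mul_rpow_neg_two_mul abs_oneModThreeIndicator_le
  have h3 : Tendsto (fun s : ℝ => 1 + (3 : ℝ) ^ (-s)) (𝓝[>] 1) (𝓝 (4 / 3)) := by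
    have hc : Continuous fun s : ℝ => 1 + (3 : ℝ) ^ (-s) :=
      continuous_const.add (Real.continuous_const_rpow (by norm_num) |>.comp continuous_neg)
    have := (hc.tendsto 1).mono_left (nhdsWithin_le_nhds (s := Ioi 1))
    rw [Real.rpow_neg_one] at this
    norm_num at this ⊢
    exact this
  have hDpos := oneModThreeSeriesTwo_pos
  have hden := (hz2.mul h3).mul hD
  have hden0 : Real.pi ^ 2 / 6 * (4 / 3) * oneModThreeSeriesTwo ≠ 0 := by positivity
  have h := (hz1.mul tendsto_tsum_chiThree).div hden hden0
  have e : 1 * (Real.pi / (3 * √3)) / (Real.pi ^ 2 / 6 * (4 / 3) * oneModThreeSeriesTwo) =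
      √3 / (2 * Real.pi * oneModThreeSeriesTwo) := by
    have h3 : √3 * √3 = (3 : ℝ) := Real.mul_self_sqrt (by norm_num)
    have h30 : √(3 : ℝ) ≠ 0 := by positivity
    field_simp
    linear_combination (-4 : ℝ) * h3
  rw [← e]
  refine h.congr' ?_
  filter_upwards [self_mem_nhdsWithin, hden.eventually_ne hden0] with s hs hne
  simp only [Pi.div_apply]
  rw [div_eq_iff hne, mul_assoc (s - 1), ← sq_tsum_sqfreeOneModThree hs]
  ring

theorem tendsto_sum_sqfreeOneModThree_div :
    Tendsto (fun x : ℝ => (∑ n ∈ Finset.Icc 1 ⌊x⌋₊, sqfreeOneModThree n / n) / √(Real.log x))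
      atTop (𝓝 (2 * √(√3 / (2 * Real.pi * oneModThreeSeriesTwo)) / √Real.pi)) := by
  have hterm : ∀ σ : ℝ, ∀ n : ℕ, sqfreeOneModThree n * (n : ℝ) ^ (-(1 + σ)) =
      sqfreeOneModThree n / n * Real.exp (-(σ * Real.log n)) := by
    intro σ n
    rcases Nat.eq_zero_or_pos n with rfl | hn
    · simp [sqfreeOneModThree_zero]
    · have hn' : (0 : ℝ) < n := by exact_mod_cast hn
      rw [neg_add, Real.rpow_add hn', Real.rpow_neg_one, Real.rpow_def_of_pos hn',
        div_eq_mul_inv, mul_assoc]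
      congr 3
      ring
  have hk := tendsto_tsum_div_sqrt_of_laplace (a := fun n => sqfreeOneModThree n / n)
    (l := fun n => Real.log n) (c := √(√3 / (2 * Real.pi * oneModThreeSeriesTwo)))
    (fun n => div_nonneg (sqfreeOneModThree_nonneg n) (Nat.cast_nonneg n))
    (fun n => Real.log_natCast_nonneg n)
    (fun σ hσ => ((summable_mul_rpow_neg abs_sqfreeOneModThree_le
      (s := 1 + σ) (by linarith)).of_norm).congr (hterm σ))
    (Real.sqrt_nonneg _) ?_
  · refine (hk.comp Real.tendsto_log_atTop).congr' ?_
    filter_upwards [eventually_ge_atTop 1] with x hx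
    simp only [Function.comp]
    congr 1
    rw [tsum_eq_sum (s := Finset.Icc 1 ⌊x⌋₊)]
    · refine Finset.sum_congr rfl fun n hn => if_pos ?_
      rw [Finset.mem_Icc] at hn
      exact Real.log_le_log (by exact_mod_cast hn.1) ((Nat.le_floor_iff (by linarith)).1 hn.2)
    · intro n hn
      rcases Nat.eq_zero_or_pos n with rfl | hn0
      · simp
      · refine if_neg fun h => hn (Finset.mem_Icc.2 ⟨hn0, (Nat.le_floor_iff (by linarith)).2 ?_⟩)
        exact (Real.log_le_log_iff (by exact_mod_cast hn0) (by linarith)).1 h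
  · have hmap : Tendsto (fun σ : ℝ => 1 + σ) (𝓝[>] 0) (𝓝[>] 1) := by
      refine tendsto_nhdsWithin_iff.2 ⟨?_, ?_⟩
      · have : Continuous fun σ : ℝ => 1 + σ := by fun_prop
        simpa using (this.tendsto 0).mono_left (nhdsWithin_le_nhds (s := Ioi 0))
      · filter_upwards [self_mem_nhdsWithin] with σ hσ
        have : (0 : ℝ) < σ := hσ
        exact lt_add_of_pos_right 1 this
    have h := ((Real.continuous_sqrt.tendsto _).comp tendsto_sub_mul_sq_tsum).comp hmap
    refine h.congr' ?_
    filter_upwards [self_mem_nhdsWithin] with σ hσ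
    have hσ' : (0 : ℝ) < σ := hσ
    simp only [Function.comp, add_sub_cancel_left, hterm]
    rw [Real.sqrt_mul hσ'.le, Real.sqrt_sq]
    exact tsum_nonneg fun n => mul_nonneg
      (div_nonneg (sqfreeOneModThree_nonneg n) (Nat.cast_nonneg n)) (Real.exp_pos _).le

/-- The constant in Landau's asymptotic for squarefree integers composed of primes congruent to
`1` modulo `3`. -/
noncomputable def landauConstant : ℝ :=
  (3 : ℝ) ^ ((1 : ℝ) / 4) / (Real.pi * Real.sqrt 2) *
    ∏' p : {p : ℕ // p.Prime ∧ p % 3 = 1}, (1 - 1 / ((p : ℕ) : ℝ) ^ 2) ^ ((1 : ℝ) / 2)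

theorem tprod_oneModThree :
    ∏' p : {p : ℕ // p.Prime ∧ p % 3 = 1}, (1 - 1 / ((p : ℕ) : ℝ) ^ 2) ^ ((1 : ℝ) / 2) =
      (oneModThreeSeriesTwo⁻¹) ^ ((1 : ℝ) / 2) := by
  have h := (hasProd_mul_rpow_neg oneModThreeIndicator abs_oneModThreeIndicator_le
    one_lt_two).inv₀ oneModThreeSeriesTwo_pos.ne'
  simp only [inv_inv] at h
  have hlt : ∀ p : Nat.Primes, 0 ≤ 1 - oneModThreeIndicator p * ((p : ℕ) : ℝ) ^ (-(2 : ℝ)) := by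
    intro p
    have h1 : ((p : ℕ) : ℝ) ^ (-(2 : ℝ)) ≤ 1 :=
      Real.rpow_le_one_of_one_le_of_nonpos (by exact_mod_cast p.2.one_le) (by norm_num)
    have h2 := (abs_le.1 (abs_oneModThreeIndicator_le p)).2
    have h3 : 0 ≤ ((p : ℕ) : ℝ) ^ (-(2 : ℝ)) := Real.rpow_nonneg (Nat.cast_nonneg _) _
    nlinarith
  have hr : HasProd (fun p : Nat.Primes =>
      (1 - oneModThreeIndicator p * ((p : ℕ) : ℝ) ^ (-(2 : ℝ))) ^ ((1 : ℝ) / 2))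
      ((oneModThreeSeriesTwo⁻¹) ^ ((1 : ℝ) / 2)) := by
    have hc : Continuous fun x : ℝ => x ^ ((1 : ℝ) / 2) :=
      Real.continuous_rpow_const (by norm_num)
    refine ((hc.tendsto _).comp h).congr fun s => ?_
    exact (Real.finsetProd_rpow s _ (fun p _ => hlt p) _).symm
  let e : {p : ℕ // p.Prime ∧ p % 3 = 1} → Nat.Primes := fun p => ⟨p, p.2.1⟩
  have he : Function.Injective e := fun p q h => Subtype.ext (congrArg (Subtype.val : Nat.Primes → ℕ) h)
  refine HasProd.tprod_eq ?_
  refine (congrArg (HasProd · _) (funext fun p => ?_)).mpr ((he.hasProd_iff fun p hp => ?_).mpr hr)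
  · simp only [Function.comp, e]
    rw [oneModThreeIndicator_apply, if_pos ((primesOneModThree_prime p.2.1).2 p.2.2), one_mul,
      Real.rpow_neg (Nat.cast_nonneg _), one_div]
    norm_cast
  · have : ¬ PrimesOneModThree p := fun h =>
      hp ⟨⟨p, p.2, (primesOneModThree_prime p.2).1 h⟩, rfl⟩
    rw [oneModThreeIndicator_apply, if_neg this]
    simp

theorem landauConstant_eq :
    landauConstant = √(√3 / (2 * Real.pi * oneModThreeSeriesTwo)) / √Real.pi := by
  have hD := oneModThreeSeriesTwo_pos
  rw [landauConstant, tprod_oneModThree, ← Real.sqrt_eq_rpow, ← Real.sqrt_div (by positivity)]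
  have h4 : (3 : ℝ) ^ ((1 : ℝ) / 4) = √√3 := by
    rw [Real.sqrt_eq_rpow, Real.sqrt_eq_rpow, ← Real.rpow_mul (by norm_num)]
    norm_num
  symm
  rw [h4, Real.sqrt_eq_iff_mul_self_eq (by positivity) (by positivity)]
  have h1 := Real.mul_self_sqrt (Real.sqrt_nonneg 3)
  have h2 := Real.mul_self_sqrt (show (0 : ℝ) ≤ 2 by norm_num)
  have h3 := Real.mul_self_sqrt (inv_pos.2 hD).le
  symm
  calc √√3 / (Real.pi * √2) * √oneModThreeSeriesTwo⁻¹ *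
        (√√3 / (Real.pi * √2) * √oneModThreeSeriesTwo⁻¹)
      = (√√3 * √√3) / (Real.pi * Real.pi * (√2 * √2)) *
          (√oneModThreeSeriesTwo⁻¹ * √oneModThreeSeriesTwo⁻¹) := by field_simp
    _ = _ := by
      rw [h1, h2, h3]
      field_simp

theorem landauConstant_pos : 0 < landauConstant := by
  have hD := oneModThreeSeriesTwo_pos
  rw [landauConstant_eq]
  positivity

theorem tendsto_sum_sqfreeOneModThree_div_landau :
    Tendsto (fun x : ℝ => (∑ n ∈ Finset.Icc 1 ⌊x⌋₊, sqfreeOneModThree n / n) / √(Real.log x))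
      atTop (𝓝 (2 * landauConstant)) := by
  rw [landauConstant_eq, ← mul_div_assoc]
  exact tendsto_sum_sqfreeOneModThree_div

end LandauConstant

section LandauCount

open Set Topology

theorem sum_Icc_sum_divisorsAntidiagonal (F : ℕ → ℕ → ℝ) (N : ℕ) :
    ∑ n ∈ Finset.Icc 1 N, ∑ q ∈ n.divisorsAntidiagonal, F q.1 q.2 =
      ∑ m ∈ Finset.Icc 1 N, ∑ d ∈ Finset.Icc 1 (N / m), F m d := by
  rw [Finset.sum_sigma', Finset.sum_sigma']
  refine Finset.sum_bij' (fun z _ => ⟨z.2.1, z.2.2⟩) (fun z _ => ⟨z.1 * z.2, (z.1, z.2)⟩)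
    ?_ ?_ ?_ ?_ ?_
  · rintro ⟨n, m, d⟩ h
    simp only [Finset.mem_sigma, Finset.mem_Icc, Nat.mem_divisorsAntidiagonal] at h ⊢
    obtain ⟨⟨h1, h2⟩, rfl, h3⟩ := h
    have hm : 0 < m := Nat.pos_of_ne_zero (left_ne_zero_of_mul h3)
    have hd : 0 < d := Nat.pos_of_ne_zero (right_ne_zero_of_mul h3)
    exact ⟨⟨hm, (Nat.le_mul_of_pos_right m hd).trans h2⟩, hd,
      (Nat.le_div_iff_mul_le hm).2 (by linarith)⟩
  · rintro ⟨m, d⟩ h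
    simp only [Finset.mem_sigma, Finset.mem_Icc, Nat.mem_divisorsAntidiagonal] at h ⊢
    obtain ⟨⟨h1, h2⟩, h3, h4⟩ := h
    have := (Nat.le_div_iff_mul_le (show 0 < m from h1)).1 h4
    have hpos : 0 < m * d := Nat.mul_pos h1 h3
    exact ⟨⟨hpos, by linarith⟩, trivial, hpos.ne'⟩
  · rintro ⟨n, m, d⟩ h
    simp only [Finset.mem_sigma, Nat.mem_divisorsAntidiagonal] at h
    obtain ⟨-, rfl, -⟩ := h
    rfl
  · rintro ⟨m, d⟩ h
    rfl
  · rintro ⟨n, m, d⟩ h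
    rfl

theorem sum_Icc_sum_divisorsAntidiagonal_mul (a g : ℕ → ℝ) (x : ℝ) :
    ∑ n ∈ Finset.Icc 1 ⌊x⌋₊, ∑ q ∈ n.divisorsAntidiagonal, a q.1 * g q.2 =
      ∑ m ∈ Finset.Icc 1 ⌊x⌋₊, a m * ∑ d ∈ Finset.Icc 1 ⌊x / m⌋₊, g d := by
  rw [sum_Icc_sum_divisorsAntidiagonal fun m d => a m * g d]
  exact Finset.sum_congr rfl fun m _ => by rw [Nat.floor_div_natCast, Finset.mul_sum]

theorem abs_sub_mul_le_of_tendsto {θ : ℝ → ℝ} {A K : ℝ} (hθ0 : ∀ y, 0 ≤ θ y)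
    (hθK : ∀ y, 0 ≤ y → θ y ≤ K * y) (hθ : Tendsto (fun y => θ y / y) atTop (𝓝 A)) {ε : ℝ}
    (hε : 0 < ε) : ∃ M, 0 ≤ M ∧ ∀ y, 0 < y → |θ y - A * y| ≤ ε * y + M := by
  obtain ⟨Y, hY⟩ := Metric.tendsto_atTop.1 hθ ε hε
  refine ⟨(|K| + |A|) * |Y|, by positivity, fun y hy => ?_⟩
  rcases le_or_gt Y y with h | h
  · have h1 := hY y h
    rw [Real.dist_eq] at h1
    have h2 : θ y - A * y = (θ y / y - A) * y := by field_simp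
    rw [h2, abs_mul, abs_of_pos hy]
    have h3 : |θ y / y - A| * y ≤ ε * y := mul_le_mul_of_nonneg_right h1.le hy.le
    have h4 : 0 ≤ (|K| + |A|) * |Y| := by positivity
    linarith
  · have hYa : y ≤ |Y| := h.le.trans (le_abs_self Y)
    have h1 : |θ y - A * y| ≤ |θ y| + |A * y| := abs_sub _ _
    rw [abs_of_nonneg (hθ0 y), abs_mul, abs_of_pos hy] at h1
    have h2 : θ y ≤ |K| * y := (hθK y hy.le).trans
      (mul_le_mul_of_nonneg_right (le_abs_self K) hy.le)
    have h3 : (|K| + |A|) * y ≤ (|K| + |A|) * |Y| :=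
      mul_le_mul_of_nonneg_left hYa (by positivity)
    have h4 : 0 ≤ ε * y := by positivity
    linarith

theorem abs_sum_mul_sub_le {θ : ℝ → ℝ} {a : ℕ → ℝ} (ha0 : ∀ n, 0 ≤ a n) (ha1 : ∀ n, a n ≤ 1)
    {A ε M : ℝ} (hM : 0 ≤ M) (h : ∀ y, 0 < y → |θ y - A * y| ≤ ε * y + M) {x : ℝ} (hx : 0 < x) :
    |∑ m ∈ Finset.Icc 1 ⌊x⌋₊, a m * θ (x / m) - A * x * ∑ m ∈ Finset.Icc 1 ⌊x⌋₊, a m / m| ≤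
      ε * x * (∑ m ∈ Finset.Icc 1 ⌊x⌋₊, a m / m) + M * x := by
  have hcard : ∑ m ∈ Finset.Icc 1 ⌊x⌋₊, M ≤ M * x := by
    rw [Finset.sum_const, Nat.card_Icc, nsmul_eq_mul, mul_comm]
    exact mul_le_mul_of_nonneg_left (by simpa using Nat.floor_le hx.le) hM
  rw [Finset.mul_sum, Finset.mul_sum, ← Finset.sum_sub_distrib]
  refine (Finset.abs_sum_le_sum_abs _ _).trans (le_trans ?_ (add_le_add_right hcard _))
  rw [← Finset.sum_add_distrib]
  refine Finset.sum_le_sum fun m hm => ?_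
  have hm0 : (0 : ℝ) < m := by exact_mod_cast (Finset.mem_Icc.1 hm).1
  have h1 : a m * θ (x / m) - A * x * (a m / m) = a m * (θ (x / m) - A * (x / m)) := by
    field_simp
  rw [h1, abs_mul, abs_of_nonneg (ha0 m)]
  have h2 := mul_le_mul_of_nonneg_left (h (x / m) (by positivity)) (ha0 m)
  have h3 : a m * (ε * (x / m) + M) = ε * x * (a m / m) + a m * M := by field_simp
  have h4 : a m * M ≤ M := mul_le_of_le_one_left hM (ha1 m)
  linarith

open Classical in
theorem sqfreeOneModThree_mul_log {n : ℕ} (hn : n ≠ 0) :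
    sqfreeOneModThree n * Real.log n = ∑ q ∈ n.divisorsAntidiagonal,
      if q.2.Prime then sqfreeOneModThree n * Real.log q.2 else 0 := by
  by_cases hs : Squarefree n
  · have h1 : Real.log n = ∑ p ∈ n.primeFactors, Real.log p := by
      rw [← Real.log_prod fun p hp => by
        exact_mod_cast (Nat.prime_of_mem_primeFactors hp).ne_zero]
      rw [← Nat.cast_prod, Nat.prod_primeFactors_of_squarefree hs]
    have h2 := Nat.sum_divisorsAntidiagonal' (n := n) fun _ p =>
      if p.Prime then sqfreeOneModThree n * Real.log p else 0
    rw [h2, h1, Finset.mul_sum, ← Finset.sum_filter]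
    refine Finset.sum_congr ?_ fun _ _ => rfl
    ext p
    simp [hn, and_comm]
  · have : sqfreeOneModThree n = 0 := if_neg fun h => hs h.1
    simp [this]

open Classical in
/-- `log p` at the primes congruent to `1` modulo `3`, and `0` elsewhere. -/
noncomputable def logOneModThree (p : ℕ) : ℝ :=
  if p.Prime ∧ p % 3 = 1 then Real.log p else 0

theorem logOneModThree_nonneg (p : ℕ) : 0 ≤ logOneModThree p := by
  unfold logOneModThree
  split_ifs
  exacts [Real.log_natCast_nonneg p, le_rfl]

theorem logOneModThree_le (p : ℕ) : logOneModThree p ≤ Real.log p := by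
  unfold logOneModThree
  split_ifs
  exacts [le_rfl, Real.log_natCast_nonneg p]

theorem logOneModThree_mul_sub {m p : ℕ} :
    0 ≤ sqfreeOneModThree m * logOneModThree p -
        (if p.Prime then sqfreeOneModThree (m * p) * Real.log p else 0) ∧
      sqfreeOneModThree m * logOneModThree p -
        (if p.Prime then sqfreeOneModThree (m * p) * Real.log p else 0) ≤
      if p ∣ m then Real.log p else 0 := by
  have hl := Real.log_natCast_nonneg p
  by_cases hp : p.Prime
  · rw [if_pos hp]
    by_cases hd : p ∣ m
    · have h0 : sqfreeOneModThree (m * p) = 0 := if_neg fun h => by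
        obtain ⟨k, rfl⟩ := hd
        exact hp.one_lt.ne' (Nat.isUnit_iff.1 (h.1 p ⟨k, by ring⟩))
      rw [h0, if_pos hd, zero_mul, sub_zero]
      exact ⟨mul_nonneg (sqfreeOneModThree_nonneg m) (logOneModThree_nonneg p),
        (mul_le_of_le_one_left (logOneModThree_nonneg p) (sqfreeOneModThree_le_one m)).trans
          (logOneModThree_le p)⟩
    · rw [if_neg hd, sqfreeOneModThree_mul ((Nat.Prime.coprime_iff_not_dvd hp).2 hd).symm,
        sqfreeOneModThree_prime hp, logOneModThree]
      by_cases h3 : p % 3 = 1 <;> simp [h3, hp]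
  · have h0 : logOneModThree p = 0 := if_neg fun h => hp h.1
    rw [if_neg hp, h0]
    split_ifs <;> simp [hl]

theorem exists_sum_log_dvd_le : ∃ M : ℝ, 0 ≤ M ∧ ∀ N : ℕ,
    ∑ n ∈ Finset.Icc 1 N, ∑ q ∈ n.divisorsAntidiagonal, (if q.2 ∣ q.1 then Real.log q.2 else 0) ≤
      M * N := by
  have hsum : Summable fun d : ℕ => Real.log d / (d : ℝ) ^ 2 := by
    refine Summable.of_nonneg_of_le
      (fun d => div_nonneg (Real.log_natCast_nonneg d) (by positivity)) (fun d => ?_)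
      ((summable_rpow_neg (s := 3 / 2) (by norm_num)).mul_left 2)
    rcases Nat.eq_zero_or_pos d with rfl | hd
    · simp [Real.zero_rpow]
    · have hd' : (0 : ℝ) < d := by exact_mod_cast hd
      have h1 := Real.log_le_rpow_div hd'.le (show (0 : ℝ) < 1 / 2 by norm_num)
      have h2 : (d : ℝ) ^ (-(3 / 2 : ℝ)) = (d : ℝ) ^ (1 / 2 : ℝ) / (d : ℝ) ^ 2 := by
        rw [← Real.rpow_natCast, ← Real.rpow_sub hd']
        norm_num
      rw [h2, ← mul_div_assoc]
      exact div_le_div_of_nonneg_right (by linarith) (by positivity)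
  refine ⟨∑' d : ℕ, Real.log d / (d : ℝ) ^ 2, tsum_nonneg fun d =>
    div_nonneg (Real.log_natCast_nonneg d) (by positivity), fun N => ?_⟩
  have hswap : ∀ n : ℕ, ∑ q ∈ n.divisorsAntidiagonal, (if q.2 ∣ q.1 then Real.log q.2 else 0) =
      ∑ q ∈ n.divisorsAntidiagonal, (if q.1 ∣ q.2 then Real.log q.1 else 0) := fun n => by
    conv_lhs => rw [← Nat.map_swap_divisorsAntidiagonal, Finset.sum_map]
    rfl
  simp only [hswap]
  rw [sum_Icc_sum_divisorsAntidiagonal fun m d => if m ∣ d then Real.log m else 0]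
  calc ∑ m ∈ Finset.Icc 1 N, ∑ d ∈ Finset.Icc 1 (N / m), (if m ∣ d then Real.log m else 0)
      ≤ ∑ m ∈ Finset.Icc 1 N, Real.log m / (m : ℝ) ^ 2 * N := by
        refine Finset.sum_le_sum fun m hm => ?_
        have hm0 : (0 : ℝ) < m := by exact_mod_cast (Finset.mem_Icc.1 hm).1
        rw [← Finset.sum_filter, Finset.sum_const, nsmul_eq_mul]
        have hc : ((Finset.Icc 1 (N / m)).filter (m ∣ ·)).card = N / m / m :=
          Nat.Ioc_filter_dvd_card_eq_div (N / m) m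
        have h1 : ((N / m / m : ℕ) : ℝ) ≤ N / (m : ℝ) ^ 2 := by
          rw [Nat.div_div_eq_div_mul, sq]
          exact_mod_cast Nat.cast_div_le (α := ℝ) (m := N) (n := m * m)
        rw [hc]
        calc ((N / m / m : ℕ) : ℝ) * Real.log m ≤ N / (m : ℝ) ^ 2 * Real.log m :=
              mul_le_mul_of_nonneg_right h1 (Real.log_natCast_nonneg m)
          _ = _ := by ring
    _ = (∑ m ∈ Finset.Icc 1 N, Real.log m / (m : ℝ) ^ 2) * N := by rw [Finset.sum_mul]
    _ ≤ _ := by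
        refine mul_le_mul_of_nonneg_right ?_ (Nat.cast_nonneg N)
        exact hsum.sum_le_tsum _ fun d _ =>
          div_nonneg (Real.log_natCast_nonneg d) (by positivity)

theorem mul_log_sub_le_sum_log (N : ℕ) :
    N * Real.log N - N ≤ ∑ n ∈ Finset.Icc 1 N, Real.log n := by
  induction N with
  | zero => simp
  | succ N ih =>
    rw [Finset.sum_Icc_succ_top (by omega)]
    rcases Nat.eq_zero_or_pos N with rfl | hN
    · simp
    · have hN' : (0 : ℝ) < N := by exact_mod_cast hN
      have h1 : Real.log ((N + 1) / N) ≤ (N + 1) / N - 1 := Real.log_le_sub_one_of_pos (by positivity)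
      rw [Real.log_div (by positivity) hN'.ne'] at h1
      have h2 : N * (Real.log (N + 1) - Real.log N) ≤ N * ((N + 1) / N - 1) :=
        mul_le_mul_of_nonneg_left h1 hN'.le
      have h3 : (N : ℝ) * ((N + 1) / N - 1) = 1 := by field_simp; ring
      push_cast
      linarith

theorem sum_log_div_le {x : ℝ} (hx : 1 ≤ x) :
    ∑ n ∈ Finset.Icc 1 ⌊x⌋₊, (Real.log x - Real.log n) ≤ x := by
  have hN : 0 < ⌊x⌋₊ := Nat.floor_pos.2 hx
  have hN' : (0 : ℝ) < ⌊x⌋₊ := by exact_mod_cast hN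
  have h1 := mul_log_sub_le_sum_log ⌊x⌋₊
  rw [Finset.sum_sub_distrib, Finset.sum_const, Nat.card_Icc, nsmul_eq_mul, Nat.add_sub_cancel]
  have h2 : Real.log (x / ⌊x⌋₊) ≤ x / ⌊x⌋₊ - 1 := Real.log_le_sub_one_of_pos (by positivity)
  rw [Real.log_div (by positivity) hN'.ne'] at h2
  have h3 := mul_le_mul_of_nonneg_left h2 hN'.le
  have h4 : (⌊x⌋₊ : ℝ) * (x / ⌊x⌋₊ - 1) = x - ⌊x⌋₊ := by field_simp
  linarith

/-- The number of squarefree integers up to `x` composed of primes congruent to `1` modulo `3`. -/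
noncomputable def sqfreeCount (x : ℝ) : ℝ := ∑ n ∈ Finset.Icc 1 ⌊x⌋₊, sqfreeOneModThree n

theorem sqfreeCount_nonneg (x : ℝ) : 0 ≤ sqfreeCount x :=
  Finset.sum_nonneg fun n _ => sqfreeOneModThree_nonneg n

theorem exists_sqfreeCount_mul_log_sub_le : ∃ M : ℝ, 0 ≤ M ∧ ∀ x : ℝ, 1 ≤ x →
    |sqfreeCount x * Real.log x - ∑ m ∈ Finset.Icc 1 ⌊x⌋₊,
      sqfreeOneModThree m * primeTheta (fun p => p % 3 = 1) (x / m)| ≤ M * x := by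
  obtain ⟨M, hM0, hM⟩ := exists_sum_log_dvd_le
  refine ⟨M + 1, by linarith, fun x hx => ?_⟩
  have hT : ∑ m ∈ Finset.Icc 1 ⌊x⌋₊,
      sqfreeOneModThree m * primeTheta (fun p => p % 3 = 1) (x / m) =
      ∑ n ∈ Finset.Icc 1 ⌊x⌋₊, ∑ q ∈ n.divisorsAntidiagonal,
        sqfreeOneModThree q.1 * logOneModThree q.2 := by
    rw [sum_Icc_sum_divisorsAntidiagonal_mul]
    refine Finset.sum_congr rfl fun m _ => congrArg _ (Finset.sum_congr rfl fun p _ => ?_)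
    unfold logOneModThree
    congr
  have hS : ∑ n ∈ Finset.Icc 1 ⌊x⌋₊, sqfreeOneModThree n * Real.log n =
      ∑ n ∈ Finset.Icc 1 ⌊x⌋₊, ∑ q ∈ n.divisorsAntidiagonal,
        if q.2.Prime then sqfreeOneModThree (q.1 * q.2) * Real.log q.2 else 0 := by
    refine Finset.sum_congr rfl fun n hn => ?_
    rw [sqfreeOneModThree_mul_log (by have := (Finset.mem_Icc.1 hn).1; omega)]
    refine Finset.sum_congr rfl fun q hq => ?_
    rw [(Nat.mem_divisorsAntidiagonal.1 hq).1]
  have h1 : 0 ≤ ∑ n ∈ Finset.Icc 1 ⌊x⌋₊, ∑ q ∈ n.divisorsAntidiagonal,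
        sqfreeOneModThree q.1 * logOneModThree q.2 -
      ∑ n ∈ Finset.Icc 1 ⌊x⌋₊, sqfreeOneModThree n * Real.log n := by
    rw [hS]
    simp only [← Finset.sum_sub_distrib]
    exact Finset.sum_nonneg fun n _ => Finset.sum_nonneg fun q _ => logOneModThree_mul_sub.1
  have h2 : ∑ n ∈ Finset.Icc 1 ⌊x⌋₊, ∑ q ∈ n.divisorsAntidiagonal,
        sqfreeOneModThree q.1 * logOneModThree q.2 -
      ∑ n ∈ Finset.Icc 1 ⌊x⌋₊, sqfreeOneModThree n * Real.log n ≤ M * x := by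
    rw [hS]
    simp only [← Finset.sum_sub_distrib]
    refine le_trans (Finset.sum_le_sum fun n _ => Finset.sum_le_sum fun q _ =>
      logOneModThree_mul_sub.2) ((hM _).trans ?_)
    exact mul_le_mul_of_nonneg_left (Nat.floor_le (by linarith)) hM0
  have h3 : sqfreeCount x * Real.log x -
      ∑ n ∈ Finset.Icc 1 ⌊x⌋₊, sqfreeOneModThree n * Real.log n =
      ∑ n ∈ Finset.Icc 1 ⌊x⌋₊, sqfreeOneModThree n * (Real.log x - Real.log n) := by
    rw [sqfreeCount, Finset.sum_mul, ← Finset.sum_sub_distrib]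
    exact Finset.sum_congr rfl fun n _ => by ring
  have hlog : ∀ n ∈ Finset.Icc 1 ⌊x⌋₊, 0 ≤ Real.log x - Real.log n := fun n hn => by
    rw [Finset.mem_Icc] at hn
    exact sub_nonneg.2 (Real.log_le_log (by exact_mod_cast hn.1)
      ((Nat.le_floor_iff (by linarith)).1 hn.2))
  have h4 : 0 ≤ ∑ n ∈ Finset.Icc 1 ⌊x⌋₊, sqfreeOneModThree n * (Real.log x - Real.log n) :=
    Finset.sum_nonneg fun n hn => mul_nonneg (sqfreeOneModThree_nonneg n) (hlog n hn)
  have h5 : ∑ n ∈ Finset.Icc 1 ⌊x⌋₊, sqfreeOneModThree n * (Real.log x - Real.log n) ≤ x :=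
    (Finset.sum_le_sum fun n hn =>
      mul_le_of_le_one_left (hlog n hn) (sqfreeOneModThree_le_one n)).trans (sum_log_div_le hx)
  rw [hT, abs_le]
  constructor <;> linarith

/-- Landau's asymptotic for squarefree integers composed of primes congruent to `1` modulo `3`. -/
theorem tendsto_sqfreeCount :
    Tendsto (fun x => sqfreeCount x * √(Real.log x) / x) atTop (𝓝 landauConstant) := by
  obtain ⟨M, hM0, hM⟩ := exists_sqfreeCount_mul_log_sub_le
  have hS := tendsto_sum_sqfreeOneModThree_div_landau
  have hC := landauConstant_pos
  have hsq : Tendsto (fun x : ℝ => √(Real.log x)) atTop atTop :=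
    Real.tendsto_sqrt_atTop.comp Real.tendsto_log_atTop
  suffices h : Tendsto (fun x => sqfreeCount x * √(Real.log x) / x - 1 / 2 *
      ((∑ n ∈ Finset.Icc 1 ⌊x⌋₊, sqfreeOneModThree n / n) / √(Real.log x))) atTop (𝓝 0) by
    have := h.add (hS.const_mul (1 / 2))
    convert this using 1
    · ext x; ring
    · congr 1; ring
  rw [Metric.tendsto_nhds]
  intro ε hε
  set η := ε / (2 * (2 * landauConstant + 1)) with hη
  have hηpos : 0 < η := by positivity
  obtain ⟨M', hM'0, hM'⟩ := abs_sub_mul_le_of_tendsto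
    (primeTheta_nonneg fun p => p % 3 = 1) (fun y hy => primeTheta_le _ hy)
    tendsto_primeTheta_one_mod_three hηpos
  have hsmall : Tendsto (fun x : ℝ => (M + M') / √(Real.log x)) atTop (𝓝 0) :=
    tendsto_const_nhds.div_atTop hsq
  filter_upwards [hsmall.eventually_lt_const (show 0 < ε / 2 by positivity),
    hS.eventually_lt_const (show 2 * landauConstant < 2 * landauConstant + 1 by linarith),
    eventually_gt_atTop 1] with x h1 h2 hx
  have hx0 : 0 < x := by linarith
  have hL : 0 < Real.log x := Real.log_pos hx
  have hr : 0 < √(Real.log x) := Real.sqrt_pos.2 hL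
  have hrr := Real.mul_self_sqrt hL.le
  have h3 := hM x hx.le
  have h4 := abs_sum_mul_sub_le sqfreeOneModThree_nonneg sqfreeOneModThree_le_one hM'0 hM' hx0
  set S := ∑ n ∈ Finset.Icc 1 ⌊x⌋₊, sqfreeOneModThree n / n
  set r := √(Real.log x)
  have h5 : |sqfreeCount x * Real.log x - 1 / 2 * x * S| ≤ η * x * S + (M + M') * x := by
    have := abs_sub_le (sqfreeCount x * Real.log x) (∑ m ∈ Finset.Icc 1 ⌊x⌋₊,
      sqfreeOneModThree m * primeTheta (fun p => p % 3 = 1) (x / m)) (1 / 2 * x * S)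
    linarith
  have h6 : sqfreeCount x * r / x - 1 / 2 * (S / r) =
      (sqfreeCount x * Real.log x - 1 / 2 * x * S) / (x * r) := by
    rw [← hrr]
    field_simp
  rw [dist_zero_right, Real.norm_eq_abs, h6, abs_div, abs_of_pos (mul_pos hx0 hr),
    div_lt_iff₀ (mul_pos hx0 hr)]
  refine h5.trans_lt ?_
  have h7 : η * x * S + (M + M') * x = (η * (S / r) + (M + M') / r) * (x * r) := by field_simp
  rw [h7]
  refine mul_lt_mul_of_pos_right ?_ (mul_pos hx0 hr)
  have h8 : η * (S / r) ≤ η * (2 * landauConstant + 1) := mul_le_mul_of_nonneg_left h2.le hηpos.le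
  have h9 : η * (2 * landauConstant + 1) = ε / 2 := by rw [hη]; field_simp
  linarith

end LandauCount

section NilpotentPrime

open Set Topology

theorem sum_mul_sum_comm (a g : ℕ → ℝ) (x : ℝ) :
    ∑ m ∈ Finset.Icc 1 ⌊x⌋₊, a m * ∑ d ∈ Finset.Icc 1 ⌊x / m⌋₊, g d =
      ∑ m ∈ Finset.Icc 1 ⌊x⌋₊, g m * ∑ d ∈ Finset.Icc 1 ⌊x / m⌋₊, a d := by
  rw [← sum_Icc_sum_divisorsAntidiagonal_mul, ← sum_Icc_sum_divisorsAntidiagonal_mul]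
  refine Finset.sum_congr rfl fun n _ => ?_
  conv_lhs => rw [← Nat.map_swap_divisorsAntidiagonal, Finset.sum_map]
  exact Finset.sum_congr rfl fun q _ => mul_comm _ _

open Classical in
/-- The indicator of the primes congruent to `2` or `5` modulo `9`. -/
noncomputable def primeTwoFiveModNine (n : ℕ) : ℝ :=
  if n.Prime ∧ (n % 9 = 2 ∨ n % 9 = 5) then 1 else 0

theorem primeTwoFiveModNine_nonneg (n : ℕ) : 0 ≤ primeTwoFiveModNine n := by
  unfold primeTwoFiveModNine
  split_ifs <;> norm_num

open Classical in
theorem primeTwoFiveModNine_mul_ite (n : ℕ) (c : ℝ) : primeTwoFiveModNine n * c =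
    if n.Prime ∧ (fun p => p % 9 = 2 ∨ p % 9 = 5) n then c else 0 := by
  unfold primeTwoFiveModNine
  by_cases h : n.Prime ∧ (n % 9 = 2 ∨ n % 9 = 5)
  · rw [if_pos h, if_pos h, one_mul]
  · rw [if_neg h, if_neg h, zero_mul]

/-- The number `n` factors as `ℓ m` with `ℓ` a prime congruent to `2` or `5` modulo `9` not dividing
`m`, and all prime divisors of `m` congruent to `1` modulo `3`. -/
def HasNilpotentFactorization (n : ℕ) : Prop :=
  ∃ ℓ m : ℕ, n = ℓ * m ∧ ℓ.Prime ∧ (ℓ % 9 = 2 ∨ ℓ % 9 = 5) ∧ ¬ ℓ ∣ m ∧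
    ∀ p : ℕ, p.Prime → p ∣ m → p % 3 = 1

open Classical in
theorem sum_primeTwoFiveModNine_mul {n : ℕ} (hn : n ≠ 0) :
    ∑ q ∈ n.divisorsAntidiagonal, primeTwoFiveModNine q.1 * sqfreeOneModThree q.2 =
      if Squarefree n ∧ HasNilpotentFactorization n then 1 else 0 := by
  have key : ∀ ℓ m : ℕ, ℓ.Prime → (ℓ % 9 = 2 ∨ ℓ % 9 = 5) → PrimesOneModThree m → ¬ ℓ ∣ m :=
    fun ℓ m hℓ h9 hm hd => by
      have := hm ℓ hℓ hd
      omega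
  split_ifs with h
  · obtain ⟨hs, ℓ, m, rfl, hℓ, h9, hd, hm⟩ := h
    rw [Finset.sum_eq_single (ℓ, m)]
    · have hsm : Squarefree m := hs.squarefree_of_dvd (Dvd.intro_left ℓ rfl)
      rw [primeTwoFiveModNine, if_pos ⟨hℓ, h9⟩, sqfreeOneModThree, if_pos ⟨hsm, hm⟩, one_mul]
    · rintro ⟨ℓ', m'⟩ hq hne
      rw [Nat.mem_divisorsAntidiagonal] at hq
      by_contra hne0
      have h1 : ℓ'.Prime ∧ (ℓ' % 9 = 2 ∨ ℓ' % 9 = 5) := by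
        by_contra hcon
        exact left_ne_zero_of_mul hne0 (if_neg hcon)
      have h2 : ℓ' = ℓ := by
        have hdvd : ℓ' ∣ ℓ * m := ⟨m', hq.1.symm⟩
        rcases h1.1.dvd_mul.1 hdvd with h3 | h3
        · exact (Nat.prime_dvd_prime_iff_eq h1.1 hℓ).1 h3
        · exact absurd h3 (key ℓ' m h1.1 h1.2 hm)
      subst h2
      exact hne (Prod.ext rfl (Nat.eq_of_mul_eq_mul_left hℓ.pos hq.1))
    · intro hq
      exact absurd (Nat.mem_divisorsAntidiagonal.2 ⟨rfl, hn⟩) hq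
  · refine Finset.sum_eq_zero fun q hq => ?_
    rw [Nat.mem_divisorsAntidiagonal] at hq
    by_contra hne0
    have h1 : q.1.Prime ∧ (q.1 % 9 = 2 ∨ q.1 % 9 = 5) := by
      by_contra hcon
      exact left_ne_zero_of_mul hne0 (if_neg hcon)
    have h2 : Squarefree q.2 ∧ PrimesOneModThree q.2 := by
      by_contra hcon
      exact right_ne_zero_of_mul hne0 (if_neg hcon)
    have h3 := key q.1 q.2 h1.1 h1.2 h2.2
    refine h ⟨?_, q.1, q.2, hq.1.symm, h1.1, h1.2, h3, h2.2⟩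
    rw [← hq.1, Nat.squarefree_mul ((Nat.Prime.coprime_iff_not_dvd h1.1).2 h3)]
    exact ⟨h1.1.prime.squarefree, h2.1⟩

theorem ncard_nilpotent_eq {x : ℝ} (hx : 0 ≤ x) :
    ({n : ℕ | 1 ≤ n ∧ (n : ℝ) ≤ x ∧ Squarefree n ∧ HasNilpotentFactorization n}.ncard : ℝ) =
      ∑ n ∈ Finset.Icc 1 ⌊x⌋₊, primeTwoFiveModNine n * sqfreeCount (x / n) := by
  classical
  have hset : {n : ℕ | 1 ≤ n ∧ (n : ℝ) ≤ x ∧ Squarefree n ∧ HasNilpotentFactorization n} =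
      ((Finset.Icc 1 ⌊x⌋₊).filter fun n => Squarefree n ∧ HasNilpotentFactorization n :
        Finset ℕ) := by
    ext n
    simp [Nat.le_floor_iff hx, and_assoc]
  rw [hset, Set.ncard_coe_finset, Finset.card_filter, Nat.cast_sum]
  refine Eq.trans ?_ (sum_Icc_sum_divisorsAntidiagonal_mul primeTwoFiveModNine
    sqfreeOneModThree x)
  refine Finset.sum_congr rfl fun n hn => ?_
  rw [sum_primeTwoFiveModNine_mul (by have := (Finset.mem_Icc.1 hn).1; omega)]
  split_ifs <;> simp

/-- The sum of the reciprocals of the primes up to `x` congruent to `2` or `5` modulo `9`. -/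
noncomputable def sumInvTwoFive (x : ℝ) : ℝ :=
  ∑ n ∈ Finset.Icc 1 ⌊x⌋₊, primeTwoFiveModNine n * (1 / n)

theorem tendsto_sumInvTwoFive :
    Tendsto (fun x => sumInvTwoFive x / Real.log (Real.log x)) atTop (𝓝 (1 / 3)) := by
  refine (tendsto_sum_inv_prime_div_log_log tendsto_primeTheta_two_five_mod_nine).congr fun x => ?_
  simp only [sumInvTwoFive, primeTwoFiveModNine_mul_ite]
  congr!

theorem tendsto_log_log : Tendsto (fun x => Real.log (Real.log x)) atTop atTop :=
  Real.tendsto_log_atTop.comp Real.tendsto_log_atTop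

theorem tendsto_sumInvTwoFive_rpow {δ : ℝ} (hδ : 0 < δ) :
    Tendsto (fun x : ℝ => sumInvTwoFive (x ^ δ) / Real.log (Real.log x)) atTop (𝓝 (1 / 3)) := by
  have h1 := tendsto_sumInvTwoFive.comp (tendsto_rpow_atTop hδ)
  have h2 : Tendsto (fun x : ℝ => Real.log δ / Real.log (Real.log x) + 1) atTop (𝓝 (0 + 1)) :=
    (tendsto_const_nhds.div_atTop tendsto_log_log).add_const 1
  have h3 := h1.mul h2
  rw [zero_add, mul_one] at h3
  refine h3.congr' ?_
  filter_upwards [tendsto_log_log.eventually_gt_atTop 0,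
    (tendsto_log_log.comp (tendsto_rpow_atTop hδ)).eventually_gt_atTop 0,
    eventually_gt_atTop 1] with x hx hx2 hx1
  simp only [Function.comp] at hx2 ⊢
  have hL := Real.log_pos hx1
  have e : Real.log (Real.log (x ^ δ)) = Real.log δ + Real.log (Real.log x) := by
    rw [Real.log_rpow (by linarith), Real.log_mul hδ.ne' hL.ne']
  rw [e] at hx2 ⊢
  field_simp

theorem sum_large_prime_le {x δ : ℝ} (hx : 1 < x) (hδ : 0 < δ) :
    ∑ n ∈ (Finset.Icc 1 ⌊x⌋₊).filter (fun n : ℕ => x ^ δ < n),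
        primeTwoFiveModNine n * sqfreeCount (x / n) ≤
      Real.log 4 * x / (δ * Real.log x) * ∑ m ∈ Finset.Icc 1 ⌊x⌋₊, sqfreeOneModThree m / m := by
  have hx0 : 0 < x := by linarith
  have hL := Real.log_pos hx
  have h1 : ∑ n ∈ (Finset.Icc 1 ⌊x⌋₊).filter (fun n : ℕ => x ^ δ < n),
        primeTwoFiveModNine n * sqfreeCount (x / n) ≤
      ∑ n ∈ Finset.Icc 1 ⌊x⌋₊,
        (primeTwoFiveModNine n * Real.log n) * sqfreeCount (x / n) / (δ * Real.log x) := by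
    refine le_trans (Finset.sum_le_sum fun n hn => ?_)
      (Finset.sum_le_sum_of_subset_of_nonneg (Finset.filter_subset _ _) fun n _ _ => ?_)
    · have hxn := (Finset.mem_filter.1 hn).2
      have h2 : δ * Real.log x ≤ Real.log n := by
        rw [← Real.log_rpow hx0]
        exact Real.log_le_log (Real.rpow_pos_of_pos hx0 _) hxn.le
      rw [le_div_iff₀ (by positivity)]
      have h3 : 0 ≤ primeTwoFiveModNine n * sqfreeCount (x / n) :=
        mul_nonneg (primeTwoFiveModNine_nonneg n) (sqfreeCount_nonneg _)
      have := mul_le_mul_of_nonneg_left h2 h3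
      linarith
    · exact div_nonneg (mul_nonneg (mul_nonneg (primeTwoFiveModNine_nonneg n)
        (Real.log_natCast_nonneg n)) (sqfreeCount_nonneg _)) (by positivity)
  refine h1.trans ?_
  rw [← Finset.sum_div, div_mul_eq_mul_div, Finset.mul_sum]
  refine div_le_div_of_nonneg_right ?_ (by positivity)
  have h4 := sum_mul_sum_comm (fun n => primeTwoFiveModNine n * Real.log n) sqfreeOneModThree x
  refine (le_of_eq h4).trans (Finset.sum_le_sum fun m hm => ?_)
  have h5 : ∑ d ∈ Finset.Icc 1 ⌊x / m⌋₊, primeTwoFiveModNine d * Real.log d ≤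
      Real.log 4 * (x / m) := by
    refine le_trans (le_of_eq ?_)
      (primeTheta_le (fun p => p % 9 = 2 ∨ p % 9 = 5) (x := x / m) (by positivity))
    simp only [primeTwoFiveModNine_mul_ite, primeTheta]
    congr!
  calc _ ≤ sqfreeOneModThree m * (Real.log 4 * (x / m)) :=
        mul_le_mul_of_nonneg_left h5 (sqfreeOneModThree_nonneg m)
    _ = _ := by ring

/-- The weighted count `∑ B(x / ℓ)` over primes `ℓ ≡ 2, 5 (mod 9)`. -/
noncomputable def nilpotentCount (x : ℝ) : ℝ :=
  ∑ n ∈ Finset.Icc 1 ⌊x⌋₊, primeTwoFiveModNine n * sqfreeCount (x / n)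

theorem eventually_sqfreeCount_bounds {δ ε : ℝ} (hδ1 : δ < 1) (hε : 0 < ε) :
    ∀ᶠ x : ℝ in atTop, ∀ n ∈ Finset.Icc 1 ⌊x ^ δ⌋₊,
      (landauConstant - ε) * (x / √(Real.log x)) * (1 / n) ≤ sqfreeCount (x / n) ∧
      sqfreeCount (x / n) ≤
        (landauConstant + ε) / √(1 - δ) * (x / √(Real.log x)) * (1 / n) := by
  obtain ⟨Y, hY⟩ := Metric.tendsto_atTop.1 tendsto_sqfreeCount ε hε
  filter_upwards [eventually_gt_atTop 1,
    (tendsto_rpow_atTop (sub_pos.2 hδ1)).eventually_ge_atTop (max Y 2)] with x hx hxY n hn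
  rw [Finset.mem_Icc] at hn
  have hx0 : 0 < x := by linarith
  have hn1 : (1 : ℝ) ≤ n := by exact_mod_cast hn.1
  have hn0 : (0 : ℝ) < n := by linarith
  have hnx : (n : ℝ) ≤ x ^ δ := (Nat.le_floor_iff (Real.rpow_nonneg hx0.le _)).1 hn.2
  have hL := Real.log_pos hx
  set y := x / n with hy
  have hyx : x ^ (1 - δ) ≤ y := by
    rw [hy, le_div_iff₀ hn0, Real.rpow_sub hx0, Real.rpow_one, div_mul_eq_mul_div,
      div_le_iff₀ (Real.rpow_pos_of_pos hx0 _)]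
    exact mul_le_mul_of_nonneg_left hnx hx0.le
  have hy2 : 2 ≤ y := (le_max_right Y 2).trans (hxY.trans hyx)
  have hyle : y ≤ x := div_le_self hx0.le hn1
  have hLy : 0 < Real.log y := Real.log_pos (by linarith)
  have hl1 : (1 - δ) * Real.log x ≤ Real.log y := by
    rw [← Real.log_rpow hx0]
    exact Real.log_le_log (Real.rpow_pos_of_pos hx0 _) hyx
  have hl2 : Real.log y ≤ Real.log x := Real.log_le_log (by linarith) hyle
  have hr2 : √(Real.log y) ≤ √(Real.log x) := Real.sqrt_le_sqrt hl2
  have hr1 : √(1 - δ) * √(Real.log x) ≤ √(Real.log y) := by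
    rw [← Real.sqrt_mul (by linarith)]
    exact Real.sqrt_le_sqrt hl1
  have hry : 0 < √(Real.log y) := Real.sqrt_pos.2 hLy
  have hrd : 0 < √(1 - δ) := Real.sqrt_pos.2 (by linarith)
  have hrx : 0 < √(Real.log x) := Real.sqrt_pos.2 hL
  have hB := hY y ((le_max_left Y 2).trans (hxY.trans hyx))
  rw [Real.dist_eq, abs_lt] at hB
  have hy0 : 0 < y := by linarith
  have hB1 : (landauConstant - ε) * y ≤ sqfreeCount y * √(Real.log y) := by
    have h : landauConstant - ε < sqfreeCount y * √(Real.log y) / y := by linarith [hB.1]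
    exact ((lt_div_iff₀ hy0).1 h).le
  have hB2 : sqfreeCount y * √(Real.log y) ≤ (landauConstant + ε) * y := by
    have h : sqfreeCount y * √(Real.log y) / y < landauConstant + ε := by linarith [hB.2]
    exact ((div_lt_iff₀ hy0).1 h).le
  have hB0 := sqfreeCount_nonneg y
  constructor
  · have h : (landauConstant - ε) * (x / √(Real.log x)) * (1 / n) =
        (landauConstant - ε) * y / √(Real.log x) := by rw [hy]; field_simp
    rw [h, div_le_iff₀ hrx]
    exact hB1.trans (mul_le_mul_of_nonneg_left hr2 hB0)
  · have h : (landauConstant + ε) / √(1 - δ) * (x / √(Real.log x)) * (1 / n) =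
        (landauConstant + ε) * y / (√(1 - δ) * √(Real.log x)) := by rw [hy]; field_simp
    rw [h, le_div_iff₀ (by positivity)]
    exact (mul_le_mul_of_nonneg_left hr1 hB0).trans hB2

theorem eventually_nilpotentCount_bounds {ε : ℝ} (hε : 0 < ε) (hε1 : ε < 1) :
    ∀ᶠ x : ℝ in atTop,
      (landauConstant - ε) * sumInvTwoFive (x ^ ε) ≤ nilpotentCount x * √(Real.log x) / x ∧
      nilpotentCount x * √(Real.log x) / x ≤
        (landauConstant + ε) / √(1 - ε) * sumInvTwoFive (x ^ ε) +
          Real.log 4 / ε * (2 * landauConstant + 1) := by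
  filter_upwards [eventually_sqfreeCount_bounds hε1 hε, eventually_gt_atTop 1,
    tendsto_sum_sqfreeOneModThree_div_landau.eventually_lt_const
      (show 2 * landauConstant < 2 * landauConstant + 1 by linarith)] with x hb hx hS
  have hx0 : 0 < x := by linarith
  have hL := Real.log_pos hx
  have hrx : 0 < √(Real.log x) := Real.sqrt_pos.2 hL
  have hrr := Real.mul_self_sqrt hL.le
  have hfilter : (Finset.Icc 1 ⌊x⌋₊).filter (fun n : ℕ => ¬ x ^ ε < n) =
      Finset.Icc 1 ⌊x ^ ε⌋₊ := by
    have hxe : x ^ ε ≤ x := by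
      simpa using Real.rpow_le_rpow_of_exponent_le hx.le hε1.le
    ext n
    simp only [Finset.mem_filter, Finset.mem_Icc, not_lt, Nat.le_floor_iff hx0.le,
      Nat.le_floor_iff (Real.rpow_nonneg hx0.le ε)]
    exact ⟨fun h => ⟨h.1.1, h.2⟩, fun h => ⟨⟨h.1, h.2.trans hxe⟩, h.2⟩⟩
  have hsplit : nilpotentCount x =
      (∑ n ∈ (Finset.Icc 1 ⌊x⌋₊).filter (fun n : ℕ => x ^ ε < n),
        primeTwoFiveModNine n * sqfreeCount (x / n)) +
      ∑ n ∈ Finset.Icc 1 ⌊x ^ ε⌋₊, primeTwoFiveModNine n * sqfreeCount (x / n) := by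
    rw [← hfilter, Finset.sum_filter_add_sum_filter_not]
    rfl
  have hlarge0 : 0 ≤ ∑ n ∈ (Finset.Icc 1 ⌊x⌋₊).filter (fun n : ℕ => x ^ ε < n),
        primeTwoFiveModNine n * sqfreeCount (x / n) := Finset.sum_nonneg fun n _ =>
    mul_nonneg (primeTwoFiveModNine_nonneg n) (sqfreeCount_nonneg _)
  have hlarge := sum_large_prime_le hx hε
  set S := ∑ m ∈ Finset.Icc 1 ⌊x⌋₊, sqfreeOneModThree m / m
  set r := √(Real.log x)
  constructor
  · have h1 : (landauConstant - ε) * (x / r) * sumInvTwoFive (x ^ ε) ≤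
        ∑ n ∈ Finset.Icc 1 ⌊x ^ ε⌋₊, primeTwoFiveModNine n * sqfreeCount (x / n) := by
      rw [sumInvTwoFive, Finset.mul_sum]
      refine Finset.sum_le_sum fun n hn => ?_
      have := mul_le_mul_of_nonneg_left (hb n hn).1 (primeTwoFiveModNine_nonneg n)
      linarith
    rw [le_div_iff₀ hx0]
    calc (landauConstant - ε) * sumInvTwoFive (x ^ ε) * x
        = (landauConstant - ε) * (x / r) * sumInvTwoFive (x ^ ε) * r := by field_simp
      _ ≤ nilpotentCount x * r := mul_le_mul_of_nonneg_right (by linarith) hrx.le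
  · have h1 : ∑ n ∈ Finset.Icc 1 ⌊x ^ ε⌋₊, primeTwoFiveModNine n * sqfreeCount (x / n) ≤
        (landauConstant + ε) / √(1 - ε) * (x / r) * sumInvTwoFive (x ^ ε) := by
      rw [sumInvTwoFive, Finset.mul_sum]
      refine Finset.sum_le_sum fun n hn => ?_
      have := mul_le_mul_of_nonneg_left (hb n hn).2 (primeTwoFiveModNine_nonneg n)
      linarith
    have h2 : Real.log 4 * x / (ε * Real.log x) * S ≤
        Real.log 4 / ε * (2 * landauConstant + 1) * (x / r) := by
      have h3 : Real.log 4 * x / (ε * Real.log x) * S =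
          Real.log 4 / ε * (S / r) * (x / r) := by
        rw [← hrr]
        field_simp
      have h4 : 0 ≤ Real.log 4 := Real.log_nonneg (by norm_num)
      rw [h3]
      exact mul_le_mul_of_nonneg_right (mul_le_mul_of_nonneg_left hS.le (by positivity))
        (by positivity)
    rw [div_le_iff₀ hx0]
    calc nilpotentCount x * r ≤ ((landauConstant + ε) / √(1 - ε) * (x / r) *
          sumInvTwoFive (x ^ ε) + Real.log 4 / ε * (2 * landauConstant + 1) * (x / r)) * r :=
          mul_le_mul_of_nonneg_right (by linarith) hrx.le
      _ = _ := by field_simp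

theorem tendsto_nilpotentCount :
    Tendsto (fun x => nilpotentCount x * √(Real.log x) / x / Real.log (Real.log x)) atTop
      (𝓝 (landauConstant / 3)) := by
  have hC := landauConstant_pos
  rw [tendsto_order]
  have hsmall : ∀ᶠ ε : ℝ in 𝓝[>] 0, 0 < ε ∧ ε < 1 :=
    Ioo_mem_nhdsGT (show (0 : ℝ) < 1 by norm_num)
  constructor
  · intro a ha
    have hlim : Tendsto (fun ε : ℝ => (landauConstant - ε) * (1 / 3)) (𝓝[>] 0)
        (𝓝 (landauConstant / 3)) := by
      have : Continuous fun ε : ℝ => (landauConstant - ε) * (1 / 3) := by fun_prop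
      convert (this.tendsto 0).mono_left nhdsWithin_le_nhds using 2
      ring
    obtain ⟨ε, hεa, hε, hε1⟩ := ((hlim.eventually_const_lt ha).and hsmall).exists
    filter_upwards [eventually_nilpotentCount_bounds hε hε1,
      ((tendsto_sumInvTwoFive_rpow hε).const_mul (landauConstant - ε)).eventually_const_lt hεa,
      tendsto_log_log.eventually_gt_atTop 0] with x hb hlt hLL
    refine hlt.trans_le ?_
    rw [← mul_div_assoc]
    exact div_le_div_of_nonneg_right hb.1 hLL.le
  · intro a ha
    have hlim : Tendsto (fun ε : ℝ => (landauConstant + ε) / √(1 - ε) * (1 / 3) + 0) (𝓝[>] 0)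
        (𝓝 (landauConstant / 3)) := by
      have h1 : ContinuousAt (fun ε : ℝ => (landauConstant + ε) / √(1 - ε) * (1 / 3) + 0) 0 := by
        refine ContinuousAt.add (ContinuousAt.mul (ContinuousAt.div (by fun_prop) ?_ ?_)
          continuousAt_const) continuousAt_const
        · exact (Real.continuous_sqrt.comp
            (by fun_prop : Continuous fun ε : ℝ => 1 - ε)).continuousAt
        · simp
      convert h1.tendsto.mono_left nhdsWithin_le_nhds using 2
      simp
      ring
    obtain ⟨ε, hεa, hε, hε1⟩ := ((hlim.eventually_lt_const ha).and hsmall).exists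
    have h2 : Tendsto (fun x : ℝ => Real.log 4 / ε * (2 * landauConstant + 1) /
        Real.log (Real.log x)) atTop (𝓝 0) := tendsto_const_nhds.div_atTop tendsto_log_log
    filter_upwards [eventually_nilpotentCount_bounds hε hε1,
      (((tendsto_sumInvTwoFive_rpow hε).const_mul
        ((landauConstant + ε) / √(1 - ε))).add h2).eventually_lt_const hεa,
      tendsto_log_log.eventually_gt_atTop 0] with x hb hlt hLL
    refine lt_of_le_of_lt ?_ hlt
    rw [← mul_div_assoc, ← add_div]
    exact div_le_div_of_nonneg_right hb.2 hLL.le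

end NilpotentPrime

/-- Let `N x` be the number of squarefree integers `1 ≤ n ≤ x` of the form `n = ℓ m` with `ℓ`
a prime `≡ 2` or `5 (mod 9)`, `ℓ ∤ m`, and all prime divisors of `m` congruent to
`1 (mod 3)`. Then `N x ~ (C/3) · x · log log x / (log x)^{1/2}` as `x → ∞`, where
`C = (3^{1/4} / (π √2)) · ∏_{p ≡ 1 (3)} (1 − 1/p²)^{1/2}`. -/
theorem squarefree_one_nilpotent_prime_asymptotic :
    Tendsto (fun x : ℝ =>
      ({n : ℕ | 1 ≤ n ∧ (n : ℝ) ≤ x ∧ Squarefree n ∧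
          ∃ ℓ m : ℕ, n = ℓ * m ∧ ℓ.Prime ∧ (ℓ % 9 = 2 ∨ ℓ % 9 = 5) ∧ ¬ ℓ ∣ m ∧
            ∀ p : ℕ, p.Prime → p ∣ m → p % 3 = 1}.ncard : ℝ) /
        ((((3 : ℝ) ^ ((1 : ℝ) / 4) / (Real.pi * Real.sqrt 2)) *
            (∏' p : {p : ℕ // p.Prime ∧ p % 3 = 1},
              (1 - 1 / ((p : ℕ) : ℝ) ^ 2) ^ ((1 : ℝ) / 2)) / 3) *
          x * Real.log (Real.log x) / Real.log x ^ ((1 : ℝ) / 2)))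
      atTop (nhds 1) := by
  have hC := landauConstant_pos
  have h := tendsto_nilpotentCount.div_const (landauConstant / 3)
  rw [div_self (by positivity)] at h
  refine h.congr' ?_
  filter_upwards [eventually_gt_atTop 1, tendsto_log_log.eventually_gt_atTop 0] with x hx hLL
  have hx0 : 0 < x := by linarith
  have hr : 0 < √(Real.log x) := Real.sqrt_pos.2 (Real.log_pos hx)
  have hcard := ncard_nilpotent_eq hx0.le
  unfold HasNilpotentFactorization at hcard
  rw [hcard, ← Real.sqrt_eq_rpow]
  change nilpotentCount x * √(Real.log x) / x / Real.log (Real.log x) / (landauConstant / 3) =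
    nilpotentCount x / (landauConstant / 3 * x * Real.log (Real.log x) / √(Real.log x))
  field_simp
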